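/- arXiv:math/0504187 — 5 statements merged into one kernel-verified Lean document; each statement's English description precedes it below -/
import Mathlib

section
/- For every t ∈ (0,1/2], the two-point set {A, B} = {(0,1), (0,−1)} is the attractor of f_t: for every point p ∈ X and every n ≥ 0, the ℓ¹-distance from the n-th iterate f_t^n(p) to the set {A,B} satisfies dist(f_t^n(p), {A,B}) ≤ 2·t^n. In particular f_t^n(p) converges to the set {A,B} as n → ∞, uniformly in p. -/
/-- The ℓ¹ metric on the plane: `d((x,y),(x',y')) = |x−x'| + |y−y'|`. -/
noncomputable def l1dist (p q : ℝ × ℝ) : ℝ := |p.1 - q.1| + |p.2 - q.2|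

/-- The rhombus `X = {(x,y) : |x| + |y| ≤ 1}` with vertices
`A=(0,1)`, `B=(0,−1)`, `C=(−1,0)`, `D=(1,0)`. -/
def rhombus : Set (ℝ × ℝ) := {p | |p.1| + |p.2| ≤ 1}

/-- The piecewise affine map `f_t` on the rhombus, mapping the four closed triangles
`ACO`, `ADO`, `BCO`, `BDO` affinely onto `APQ`, `BRS`, `AQP`, `BSR` respectively. -/
noncomputable def fpw (t : ℝ) (p : ℝ × ℝ) : ℝ × ℝ :=
  if p.1 ≤ 0 then
    (if 0 ≤ p.2 then (2*t*p.1 - t*p.2 + t, 1 - t + t*p.2)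
     else (-2*t*p.1 - t*p.2 - t, 1 - t - t*p.2))
  else
    (if 0 ≤ p.2 then (-2*t*p.1 - t*p.2 + t, -1 + t - t*p.2)
     else (2*t*p.1 - t*p.2 - t, -1 + t + t*p.2))

/-- Two points lie in the same piece of the piecewise definition of `f_t`,
i.e. they satisfy the same pair of sign conditions among `{x ≤ 0, x > 0} × {y ≥ 0, y < 0}`. -/
def samePiece (p q : ℝ × ℝ) : Prop := (p.1 ≤ 0 ↔ q.1 ≤ 0) ∧ (0 ≤ p.2 ↔ 0 ≤ q.2)

lemma fpw_step (t : ℝ) (ht0 : 0 < t) (ht : t ≤ 1/2) (p : ℝ × ℝ) (hp : |p.1| + |p.2| ≤ 1) :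
    |(fpw t p).1| + |(fpw t p).2| ≤ 1 ∧ 1 - |(fpw t p).2| = t * (1 - |p.2|) := by
  obtain ⟨x, y⟩ := p
  simp only at hp
  have key : ∀ a b : ℝ, |a| ≤ t * (1 - |y|) → |b| = 1 - t * (1 - |y|) →
      |a| + |b| ≤ 1 ∧ 1 - |b| = t * (1 - |y|) := by
    intro a b h1 h2
    constructor <;> linarith
  have hs : t * (1 - |y|) ≤ 1 := by nlinarith [abs_nonneg y]
  have hx : t * (|x| + |y|) ≤ t * 1 := mul_le_mul_of_nonneg_left hp ht0.le
  have hx0 : 0 ≤ t * |x| := by positivity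
  unfold fpw
  simp only
  split_ifs with h1 h2 h2 <;> apply key
  all_goals
    first
      | rw [abs_of_nonpos h1] at *
      | rw [abs_of_pos (not_le.mp h1)] at *
    first
      | rw [abs_of_nonneg h2] at *
      | rw [abs_of_neg (not_le.mp h2)] at *
    first
      | (rw [abs_le]; constructor <;> nlinarith)
      | (rw [abs_of_nonneg (by nlinarith)]; ring)
      | (rw [abs_of_nonpos (by nlinarith)]; ring)

lemma fpw_iter (t : ℝ) (ht0 : 0 < t) (ht : t ≤ 1/2) (p : ℝ × ℝ) (hp : |p.1| + |p.2| ≤ 1) (n : ℕ) :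
    |((fpw t)^[n] p).1| + |((fpw t)^[n] p).2| ≤ 1 ∧ 1 - |((fpw t)^[n] p).2| ≤ t ^ n := by
  induction n with
  | zero => exact ⟨hp, by simp⟩
  | succ n ih =>
    rw [Function.iterate_succ_apply']
    obtain ⟨h1, h2⟩ := fpw_step t ht0 ht _ ih.1
    refine ⟨h1, ?_⟩
    rw [h2, pow_succ, mul_comm]
    exact mul_le_mul_of_nonneg_right ih.2 ht0.le

/-- For every `t ∈ (0,1/2]`, the two-point set `{A,B} = {(0,1),(0,−1)}` is
the attractor of `f_t`: for every `p ∈ X` and every `n ≥ 0`, the ℓ¹-distance from `f_t^n(p)`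
to `{A,B}` is at most `2·tⁿ`. -/
theorem fpw_attractor (t : ℝ) (ht0 : 0 < t) (ht : t ≤ 1/2)
    (p : ℝ × ℝ) (hp : p ∈ rhombus) (n : ℕ) :
    min (l1dist ((fpw t)^[n] p) (0, 1)) (l1dist ((fpw t)^[n] p) (0, -1)) ≤ 2 * t ^ n := by
  obtain ⟨h1, h2⟩ := fpw_iter t ht0 ht p hp n
  generalize (fpw t)^[n] p = q at *
  obtain ⟨x, y⟩ := q
  simp only [l1dist, sub_zero] at *
  have hx := abs_nonneg x
  rcases le_total 0 y with hy | hy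
  · apply (min_le_left _ _).trans
    rw [abs_of_nonneg hy] at *
    rw [abs_of_nonpos (by linarith : y - 1 ≤ 0)]
    linarith
  · apply (min_le_right _ _).trans
    rw [abs_of_nonpos hy] at *
    rw [abs_of_nonneg (by linarith : 0 ≤ y - -1)]
    linarith
end

section
/- Let f = f_{1/2} be the midpoint version of the piecewise affine map on the rhombus X, and take ε = 1/2. Then for every n ≥ 1 there exists an (n,1/2)-spanning set for f (with respect to the ℓ¹ metric) of cardinality at most 2^{n+3}: N(f, n, 1/2) ≤ 2^{n+3}. Indeed, if the segment CD is partitioned into 2^n equal subintervals Z_iZ_{i+1}, then each of the 2^{n+1} triangles AZ_iZ_{i+1} and BZ_iZ_{i+1} is covered by two d_n^f-balls of radius 1/2. -/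
/-- Sign attached to the upper (`true`) or lower (`false`) half of the rhombus. -/
noncomputable def sgB (b : Bool) : ℝ := if b then 1 else -1

/-- Point with cone coordinates `(s, u)` seen from the vertex `A` or `B`. -/
noncomputable def cpt (b : Bool) (s u : ℝ) : ℝ × ℝ := (u * s, sgB b * (1 - s))

/-- `p` lies in the (upper or lower) cone at height `s` from its vertex. -/
def inCone (b : Bool) (s : ℝ) (p : ℝ × ℝ) : Prop :=
  p.2 = sgB b * (1 - s) ∧ 0 ≤ s ∧ s ≤ 1 ∧ |p.1| ≤ s ∧ (b = false → s < 1)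

theorem fpw_neg (b : Bool) (s : ℝ) (p : ℝ × ℝ) (h : inCone b s p) (hx : p.1 ≤ 0) :
    fpw (1/2) p = (sgB b * (p.1 + s / 2), 1 - s / 2) := by
  obtain ⟨h1, h2, h3, h4, h5⟩ := h
  unfold fpw
  cases b
  · have h6 := h5 rfl
    simp only [sgB] at *
    norm_num at h1
    have : ¬ (0 ≤ p.2) := by linarith
    rw [if_pos hx, if_neg this]
    ext <;> norm_num <;> linarith
  · simp only [sgB] at *
    norm_num at h1
    have : (0 ≤ p.2) := by linarith
    rw [if_pos hx, if_pos this]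
    ext <;> norm_num <;> linarith

theorem fpw_pos (b : Bool) (s : ℝ) (p : ℝ × ℝ) (h : inCone b s p) (hx : 0 < p.1) :
    fpw (1/2) p = (sgB b * (s / 2 - p.1), -(1 - s / 2)) := by
  obtain ⟨h1, h2, h3, h4, h5⟩ := h
  unfold fpw
  have hx' : ¬ (p.1 ≤ 0) := by linarith
  cases b
  · have h6 := h5 rfl
    simp only [sgB] at *
    norm_num at h1
    have : ¬ (0 ≤ p.2) := by linarith
    rw [if_neg hx', if_neg this]
    ext <;> norm_num <;> linarith
  · simp only [sgB] at *
    norm_num at h1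
    have : (0 ≤ p.2) := by linarith
    rw [if_neg hx', if_pos this]
    ext <;> norm_num <;> linarith

theorem sgB_cases (b : Bool) : sgB b = 1 ∨ sgB b = -1 := by
  cases b <;> simp [sgB]

theorem inCone_cpt (b : Bool) (r v : ℝ) (hr : 0 < r) (hr1 : r < 1) (hv : |v| < 1) :
    inCone b r (cpt b r v) := by
  refine ⟨rfl, hr.le, hr1.le, ?_, fun _ => hr1⟩
  simp only [cpt, abs_mul, abs_of_pos hr]
  nlinarith

theorem fpw_inCone_neg (b : Bool) (s : ℝ) (p : ℝ × ℝ) (h : inCone b s p) (hx : p.1 ≤ 0) :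
    inCone true (s / 2) (fpw (1/2) p) := by
  rw [fpw_neg b s p h hx]
  obtain ⟨h1, h2, h3, h4, h5⟩ := h
  rw [abs_le] at h4
  refine ⟨by simp [sgB], by linarith, by linarith, ?_, by simp⟩
  rcases sgB_cases b with e | e <;> simp only [e] <;> rw [abs_le] <;> constructor <;> linarith

theorem fpw_inCone_pos (b : Bool) (s : ℝ) (p : ℝ × ℝ) (h : inCone b s p) (hx : 0 < p.1) :
    inCone false (s / 2) (fpw (1/2) p) := by
  rw [fpw_pos b s p h hx]
  obtain ⟨h1, h2, h3, h4, h5⟩ := h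
  rw [abs_le] at h4
  refine ⟨by simp [sgB], by linarith, by linarith, ?_, fun _ => by linarith⟩
  rcases sgB_cases b with e | e <;> simp only [e] <;> rw [abs_le] <;> constructor <;> linarith

theorem cone_dist_zero (b : Bool) (s r v c : ℝ) (p : ℝ × ℝ) (h : inCone b s p) (hv : |v| < 1)
    (hc : |p.1 - v * s| ≤ c) : l1dist p (cpt b r v) ≤ 2 * |s - r| + c := by
  have e1 : |p.2 - (cpt b r v).2| = |s - r| := by
    rw [h.1]
    simp only [cpt]
    rcases sgB_cases b with e | e <;> rw [e]
    · rw [abs_sub_comm s r]; congr 1; ring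
    · congr 1; ring
  have e2 : |p.1 - (cpt b r v).1| ≤ c + |s - r| := by
    have : p.1 - (cpt b r v).1 = (p.1 - v * s) + v * (s - r) := by simp only [cpt]; ring
    rw [this]
    refine (abs_add_le _ _).trans ?_
    rw [abs_mul]
    nlinarith [abs_nonneg (s - r)]
  unfold l1dist
  linarith

theorem main_claim (n : ℕ) : ∀ b : Bool, ∃ V : Finset ℝ, V.card ≤ 2 ^ n ∧ (∀ v ∈ V, |v| < 1) ∧
    ∀ s p, inCone b s p → ∃ v ∈ V, |p.1 - v * s| ≤ s * (1/2) ^ n ∧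
      ∀ r, 0 < r → r < 1 → ∀ i < n,
        l1dist ((fpw (1/2))^[i] p) ((fpw (1/2))^[i] (cpt b r v)) ≤
          2 * |s - r| + s * (1/2) ^ n := by
  classical
  induction n with
  | zero =>
    intro b
    refine ⟨{0}, by simp, by simp, fun s p h => ⟨0, by simp, ?_, by simp⟩⟩
    simpa using h.2.2.2.1
  | succ n ih =>
    intro b
    obtain ⟨V, hVc, hV, hVs⟩ := ih true
    obtain ⟨W, hWc, hW, hWs⟩ := ih false
    have hneg : ∀ w : ℝ, |w| < 1 → |(sgB b * w - 1) / 2| < 1 ∧ (sgB b * w - 1) / 2 < 0 := by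
      intro w hw
      rw [abs_lt] at hw
      rw [abs_lt]
      rcases sgB_cases b with e | e <;> rw [e] <;> refine ⟨⟨?_, ?_⟩, ?_⟩ <;> linarith
    have hpos : ∀ w : ℝ, |w| < 1 → |(1 - sgB b * w) / 2| < 1 ∧ 0 < (1 - sgB b * w) / 2 := by
      intro w hw
      rw [abs_lt] at hw
      rw [abs_lt]
      rcases sgB_cases b with e | e <;> rw [e] <;> refine ⟨⟨?_, ?_⟩, ?_⟩ <;> linarith
    refine ⟨V.image (fun w => (sgB b * w - 1) / 2) ∪ W.image (fun w => (1 - sgB b * w) / 2),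
      ?_, ?_, ?_⟩
    · refine (Finset.card_union_le _ _).trans ?_
      have h1 := (Finset.card_image_le (s := V) (f := fun w => (sgB b * w - 1) / 2))
      have h2 := (Finset.card_image_le (s := W) (f := fun w => (1 - sgB b * w) / 2))
      rw [pow_succ]
      omega
    · intro v hv
      rw [Finset.mem_union, Finset.mem_image, Finset.mem_image] at hv
      rcases hv with ⟨w, hw, rfl⟩ | ⟨w, hw, rfl⟩
      · exact (hneg w (hV w hw)).1
      · exact (hpos w (hW w hw)).1
    · intro s p h
      have hs := h.2.1
      rcases le_or_gt p.1 0 with hx | hx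
      · obtain ⟨w, hw, hw1, hw2⟩ := hVs _ _ (fpw_inCone_neg b s p h hx)
        obtain ⟨hv1, hv2⟩ := hneg w (hV w hw)
        have hd : |p.1 - (sgB b * w - 1) / 2 * s| ≤ s * (1/2) ^ (n + 1) := by
          rw [fpw_neg b s p h hx] at hw1
          rw [show s * (1/2 : ℝ) ^ (n + 1) = s / 2 * (1/2) ^ n by ring]
          refine le_of_eq_of_le ?_ hw1
          rcases sgB_cases b with e | e <;> simp only [e]
          · congr 1; ring
          · rw [← abs_neg]; congr 1; ring
        refine ⟨_, Finset.mem_union_left _ (Finset.mem_image_of_mem _ hw), hd, ?_⟩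
        intro r hr hr1 i hi
        cases i with
        | zero => exact cone_dist_zero b s r _ _ p h hv1 hd
        | succ i =>
          have hq := inCone_cpt b r _ hr hr1 hv1
          have hf : fpw (1/2) (cpt b r ((sgB b * w - 1) / 2)) = cpt true (r / 2) w := by
            rw [fpw_neg b r _ hq (by simp only [cpt]; nlinarith)]
            simp only [cpt]
            rcases sgB_cases b with e | e <;> rw [e] <;> ext <;> simp [sgB] <;> ring
          rw [Function.iterate_succ_apply, Function.iterate_succ_apply, hf]
          refine (hw2 (r / 2) (by linarith) (by linarith) i (by omega)).trans ?_
          rw [show s / 2 - r / 2 = (s - r) / 2 by ring, abs_div, abs_two, pow_succ]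
          linarith [abs_nonneg (s - r)]
      · obtain ⟨w, hw, hw1, hw2⟩ := hWs _ _ (fpw_inCone_pos b s p h hx)
        obtain ⟨hv1, hv2⟩ := hpos w (hW w hw)
        have hd : |p.1 - (1 - sgB b * w) / 2 * s| ≤ s * (1/2) ^ (n + 1) := by
          rw [fpw_pos b s p h hx] at hw1
          rw [show s * (1/2 : ℝ) ^ (n + 1) = s / 2 * (1/2) ^ n by ring]
          refine le_of_eq_of_le ?_ hw1
          rcases sgB_cases b with e | e <;> simp only [e]
          · rw [← abs_neg]; congr 1; ring
          · congr 1; ring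
        refine ⟨_, Finset.mem_union_right _ (Finset.mem_image_of_mem _ hw), hd, ?_⟩
        intro r hr hr1 i hi
        cases i with
        | zero => exact cone_dist_zero b s r _ _ p h hv1 hd
        | succ i =>
          have hq := inCone_cpt b r _ hr hr1 hv1
          have hf : fpw (1/2) (cpt b r ((1 - sgB b * w) / 2)) = cpt false (r / 2) w := by
            rw [fpw_pos b r _ hq (by simp only [cpt]; positivity)]
            simp only [cpt]
            rcases sgB_cases b with e | e <;> rw [e] <;> ext <;> simp [sgB] <;> ring
          rw [Function.iterate_succ_apply, Function.iterate_succ_apply, hf]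
          refine (hw2 (r / 2) (by linarith) (by linarith) i (by omega)).trans ?_
          rw [show s / 2 - r / 2 = (s - r) / 2 by ring, abs_div, abs_two, pow_succ]
          linarith [abs_nonneg (s - r)]

theorem exists_cone (p : ℝ × ℝ) (hp : p ∈ rhombus) : ∃ b s, inCone b s p := by
  have hp' : |p.1| + |p.2| ≤ 1 := hp
  have h1 := abs_nonneg p.1
  rcases le_or_gt 0 p.2 with h | h
  · rw [abs_of_nonneg h] at hp'
    exact ⟨true, 1 - p.2, by simp [sgB], by linarith, by linarith, by linarith, by simp⟩
  · rw [abs_of_neg h] at hp'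
    exact ⟨false, 1 + p.2, by simp [sgB], by linarith, by linarith, by linarith,
      fun _ => by linarith⟩

theorem cone_rhombus (b : Bool) (s : ℝ) (p : ℝ × ℝ) (h : inCone b s p) : p ∈ rhombus := by
  obtain ⟨h1, h2, h3, h4, h5⟩ := h
  change |p.1| + |p.2| ≤ 1
  have : |p.2| = 1 - s := by
    rw [h1]
    rcases sgB_cases b with e | e <;> rw [e]
    · rw [one_mul, abs_of_nonneg (by linarith)]
    · rw [neg_one_mul, abs_neg, abs_of_nonneg (by linarith)]
  linarith

/-- Four heights such that every `s ∈ [0,1]` is within `1/8` of one of them. -/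
noncomputable def heights : Finset ℝ := {1/8, 3/8, 5/8, 7/8}

theorem heights_mem (r : ℝ) (hr : r ∈ heights) : 0 < r ∧ r < 1 := by
  simp only [heights, Finset.mem_insert, Finset.mem_singleton] at hr
  rcases hr with rfl | rfl | rfl | rfl <;> norm_num

theorem heights_near (s : ℝ) (h0 : 0 ≤ s) (h1 : s ≤ 1) : ∃ r ∈ heights, |s - r| ≤ 1/8 := by
  simp only [heights, Finset.mem_insert, Finset.mem_singleton, exists_eq_or_imp,
    exists_eq_left, abs_le]
  rcases le_total s (1/4) with h | h
  · left; constructor <;> linarith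
  rcases le_total s (1/2) with h | h
  · right; left; constructor <;> linarith
  rcases le_total s (3/4) with h | h
  · right; right; left; constructor <;> linarith
  · right; right; right; constructor <;> linarith

theorem span_one (p : ℝ × ℝ) (hp : p ∈ rhombus) :
    ∃ q ∈ ({(1/2, 0), (-1/2, 0), (0, 1/2), (0, -1/2)} : Finset (ℝ × ℝ)), l1dist p q ≤ 1/2 := by
  have hp' : |p.1| + |p.2| ≤ 1 := hp
  simp only [Finset.mem_insert, Finset.mem_singleton, exists_eq_or_imp, exists_eq_left, l1dist]
  rcases le_total |p.2| |p.1| with h | h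
  · rcases le_total 0 p.1 with h' | h'
    · left
      rw [abs_of_nonneg h'] at *
      rw [sub_zero]
      rcases abs_cases (p.1 - 1/2) with e | e <;> linarith
    · right; left
      rw [abs_of_nonpos h'] at *
      rw [sub_zero]
      rcases abs_cases (p.1 - -1/2) with e | e <;> linarith
  · rcases le_total 0 p.2 with h' | h'
    · right; right; left
      rw [abs_of_nonneg h'] at *
      rw [sub_zero]
      rcases abs_cases (p.2 - 1/2) with e | e <;> linarith
    · right; right; right
      rw [abs_of_nonpos h'] at *
      rw [sub_zero]
      rcases abs_cases (p.2 - -1/2) with e | e <;> linarith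

/-- For `f = f_{1/2}` and `ε = 1/2`: for every `n ≥ 1`, there exists an
`(n,1/2)`-spanning set `F ⊆ X` for `f` with respect to the ℓ¹ metric (every point of `X` is
within iterated-distance `d_n^f ≤ 1/2` of some point of `F`) of cardinality at most `2^(n+3)`.
Hence `N(f,n,1/2) ≤ 2^(n+3)`. -/
theorem spanning_upper_bound (n : ℕ) (hn : 1 ≤ n) :
    ∃ F : Finset (ℝ × ℝ), ↑F ⊆ rhombus ∧
      (∀ p ∈ rhombus, ∃ q ∈ F,
        ∀ i < n, l1dist ((fpw (1/2))^[i] p) ((fpw (1/2))^[i] q) ≤ 1/2) ∧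
      F.card ≤ 2 ^ (n + 3) := by
  classical
  rcases hn.eq_or_lt with rfl | hn2
  · refine ⟨{(1/2, 0), (-1/2, 0), (0, 1/2), (0, -1/2)}, ?_, ?_, ?_⟩
    · intro p hp
      simp only [Finset.coe_insert, Finset.coe_singleton, Set.mem_insert_iff,
        Set.mem_singleton_iff] at hp
      change |p.1| + |p.2| ≤ 1
      rcases hp with rfl | rfl | rfl | rfl <;> norm_num [abs_le]
    · intro p hp
      obtain ⟨q, hq, hd⟩ := span_one p hp
      refine ⟨q, hq, fun i hi => ?_⟩
      obtain rfl : i = 0 := by omega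
      exact hd
    · exact Finset.card_le_four.trans (by norm_num)
  · choose V hVc hV hVs using main_claim n
    refine ⟨(Finset.univ : Finset Bool).biUnion
      (fun b => (heights ×ˢ V b).image (fun z => cpt b z.1 z.2)), ?_, ?_, ?_⟩
    · intro q hq
      simp only [Finset.mem_coe, Finset.mem_biUnion, Finset.mem_image, Finset.mem_product] at hq
      obtain ⟨b, -, ⟨r, v⟩, ⟨hr, hv⟩, rfl⟩ := hq
      obtain ⟨h0, h1⟩ := heights_mem r hr
      exact cone_rhombus b r _ (inCone_cpt b r v h0 h1 (hV b v hv))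
    · intro p hp
      obtain ⟨b, s, h⟩ := exists_cone p hp
      obtain ⟨v, hv, -, hd⟩ := hVs b s p h
      obtain ⟨r, hr, hsr⟩ := heights_near s h.2.1 h.2.2.1
      obtain ⟨h0, h1⟩ := heights_mem r hr
      refine ⟨cpt b r v, ?_, fun i hi => (hd r h0 h1 i hi).trans ?_⟩
      · simp only [Finset.mem_biUnion, Finset.mem_image, Finset.mem_product]
        exact ⟨b, Finset.mem_univ _, (r, v), ⟨hr, hv⟩, rfl⟩
      · have e : (1/2 : ℝ) ^ n ≤ (1/2) ^ 2 :=
          pow_le_pow_of_le_one (by norm_num) (by norm_num) hn2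
        have e0 : (0 : ℝ) ≤ (1/2) ^ n := by positivity
        have e2 : s * (1/2 : ℝ) ^ n ≤ 1 * (1/2) ^ 2 :=
          mul_le_mul h.2.2.1 e e0 (by norm_num)
        norm_num at e2 ⊢
        linarith
    · have hb : ∀ b ∈ (Finset.univ : Finset Bool),
          ((heights ×ˢ V b).image (fun z => cpt b z.1 z.2)).card ≤ 4 * 2 ^ n := by
        intro b _
        refine Finset.card_image_le.trans ?_
        rw [Finset.card_product]
        exact Nat.mul_le_mul Finset.card_le_four (hVc b)
      refine (Finset.card_biUnion_le_card_mul _ _ _ hb).trans ?_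
      rw [Finset.card_univ, Fintype.card_bool, pow_add]
      omega
end

section
/- The topological entropy of the midpoint map f = f_{1/2} on the rhombus X equals log 2: h(f) = log 2. Thus f is a piecewise affine, piecewise (non-strictly) contracting map of a compact two-dimensional region with positive topological entropy. -/
open Set Uniformity

/-- The sign attached to a boolean. -/
noncomputable def sgb (b : Bool) : ℝ := if b then 1 else -1

lemma fpw_half_snd_nonneg (p : ℝ × ℝ) : 0 ≤ (fpw (1/2) p).2 ↔ p.1 ≤ 0 := by
  unfold fpw
  split_ifs with h1 h2 h2
  · simp only [h1, iff_true]; linarith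
  · simp only [h1, iff_true]; push Not at h2; linarith
  · simp only [h1, iff_false]; push Not; linarith
  · simp only [h1, iff_false]; push Not at h2 ⊢; linarith

lemma fpw_half_nonexp (p q : ℝ × ℝ) (h : samePiece p q) :
    l1dist (fpw (1/2) p) (fpw (1/2) q) ≤ l1dist p q := by
  obtain ⟨x, y⟩ := p
  obtain ⟨a, b⟩ := q
  obtain ⟨h1, h2⟩ := h
  have key : ∀ X Y X' Y' : ℝ, |X'| ≤ |X| + |Y| / 2 → |Y'| ≤ |Y| / 2 →
      |X'| + |Y'| ≤ |X| + |Y| := by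
    intros; linarith
  unfold fpw l1dist
  simp only at h1 h2 ⊢
  by_cases hx : x ≤ 0 <;> by_cases hy : 0 ≤ y
  all_goals
    have hx' := hx
    have hy' := hy
    rw [h1] at hx'
    rw [h2] at hy'
    simp only [hx, hy, hx', hy', if_true, if_false]
    apply key
    · rw [abs_le]
      constructor <;>
      cases abs_cases (x - a) <;> cases abs_cases (y - b) <;> linarith
    · rw [abs_le]
      constructor <;> cases abs_cases (y - b) <;> linarith

lemma fpw_half_iter (p q : ℝ × ℝ) (n : ℕ) (h0 : 0 ≤ p.2 ↔ 0 ≤ q.2)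
    (h : ∀ i < n, (((fpw (1/2))^[i] p).1 ≤ 0 ↔ ((fpw (1/2))^[i] q).1 ≤ 0)) :
    ∀ i ≤ n, l1dist ((fpw (1/2))^[i] p) ((fpw (1/2))^[i] q) ≤ l1dist p q ∧
      (0 ≤ ((fpw (1/2))^[i] p).2 ↔ 0 ≤ ((fpw (1/2))^[i] q).2) := by
  intro i
  induction i with
  | zero => intro _; exact ⟨le_rfl, h0⟩
  | succ i ih =>
    intro hi
    obtain ⟨ih1, ih2⟩ := ih (by omega)
    rw [Function.iterate_succ_apply', Function.iterate_succ_apply']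
    refine ⟨(fpw_half_nonexp _ _ ⟨h i (by omega), ih2⟩).trans ih1, ?_⟩
    rw [fpw_half_snd_nonneg, fpw_half_snd_nonneg]
    exact h i (by omega)

lemma dist_le_l1dist (p q : ℝ × ℝ) : dist p q ≤ l1dist p q := by
  unfold l1dist
  rw [Prod.dist_eq, Real.dist_eq, Real.dist_eq]
  have := abs_nonneg (p.1 - q.1)
  have := abs_nonneg (p.2 - q.2)
  apply max_le <;> linarith

lemma l1dist_le_dist (p q : ℝ × ℝ) : l1dist p q ≤ 2 * dist p q := by
  unfold l1dist
  rw [Prod.dist_eq, Real.dist_eq, Real.dist_eq]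
  have := le_max_left |p.1 - q.1| |p.2 - q.2|
  have := le_max_right |p.1 - q.1| |p.2 - q.2|
  linarith

lemma rhombus_totallyBounded : TotallyBounded rhombus := by
  refine (isCompact_closedBall (0 : ℝ × ℝ) 1).totallyBounded.subset ?_
  intro p hp
  have hp' : |p.1| + |p.2| ≤ 1 := hp
  rw [Metric.mem_closedBall]
  refine (dist_le_l1dist _ _).trans ?_
  simpa [l1dist] using hp'

lemma coverMincard_bound (U : SetRel (ℝ × ℝ) (ℝ × ℝ)) (hU : U ∈ 𝓤 (ℝ × ℝ)) :
    ∃ C : ℕ, ∀ n, Dynamics.coverMincard (fpw (1/2)) rhombus U n ≤ ((C * 2 ^ n : ℕ) : ℕ∞) := by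
  classical
  obtain ⟨ε, hε, hεU⟩ := Metric.mem_uniformity_dist.1 hU
  obtain ⟨t, ht, hcov⟩ := Metric.totallyBounded_iff.1 rhombus_totallyBounded (ε / 4) (by positivity)
  have hc : ∀ p : rhombus, ∃ c : t, dist p.1 c.1 < ε / 4 := by
    intro p
    have := hcov p.2
    simp only [mem_iUnion, Metric.mem_ball] at this
    obtain ⟨c, hc, hd⟩ := this
    exact ⟨⟨c, hc⟩, hd⟩
  choose c hc using hc
  have := ht.fintype
  refine ⟨2 * Fintype.card t, fun n => ?_⟩
  let κ : rhombus → (t × Bool) × (Fin n → Bool) := fun p =>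
    ((c p, decide (0 ≤ p.1.2)), fun i => decide (((fpw (1/2))^[i] p.1).1 ≤ 0))
  let g : (t × Bool) × (Fin n → Bool) → ℝ × ℝ := fun k =>
    if h : ∃ p, κ p = k then (h.choose : ℝ × ℝ) else 0
  have hcover : Dynamics.IsDynCoverOf (fpw (1/2)) rhombus U n
      ((Finset.univ.image g : Finset (ℝ × ℝ)) : Set (ℝ × ℝ)) := by
    intro p hp
    refine ⟨g (κ ⟨p, hp⟩), by simp, ?_⟩
    have hex : ∃ q, κ q = κ ⟨p, hp⟩ := ⟨_, rfl⟩
    have hg : g (κ ⟨p, hp⟩) = (hex.choose : ℝ × ℝ) := by simp only [g]; rw [dif_pos hex]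
    rw [hg]
    have hq := hex.choose_spec
    generalize hex.choose = q at hq
    simp only [κ, Prod.mk.injEq, decide_eq_decide, funext_iff] at hq
    obtain ⟨⟨hq1, hq2⟩, hq3⟩ := hq
    change (p, q.1) ∈ Dynamics.dynEntourage _ _ _
    rw [Dynamics.mem_dynEntourage]
    intro k hk
    apply hεU
    have hit := (fpw_half_iter p q.1 n hq2.symm
      (fun i hi => (hq3 ⟨i, hi⟩).symm) k hk.le).1
    have h1 := hc ⟨p, hp⟩
    have h2 := hc q
    rw [hq1] at h2
    have h3 := dist_triangle_right p q.1 (c ⟨p, hp⟩ : ℝ × ℝ)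
    have h4 := l1dist_le_dist p q.1
    have h5 := dist_le_l1dist ((fpw (1/2))^[k] p) ((fpw (1/2))^[k] q.1)
    simp only at h1
    linarith
  refine hcover.coverMincard_le_card.trans ?_
  norm_cast
  refine Finset.card_image_le.trans ?_
  simp [Fintype.card_prod, mul_comm]

lemma exists_itinerary (n : ℕ) : ∀ (w : ℕ → Bool) (h : ℝ), 0 < h → h ≤ 1/2 →
    ∃ u : ℝ, |u| < 1 ∧ ∀ i ≤ n,
      1/2 ≤ sgb (w i) * ((fpw (1/2))^[i] (u * h, sgb (w 0) * (1 - h))).2 := by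
  have base : ∀ (b : Bool) (h : ℝ), h ≤ 1/2 → 1/2 ≤ sgb b * (sgb b * (1 - h)) := by
    intro b h hh
    cases b <;> simp [sgb] <;> linarith
  induction n with
  | zero =>
    intro w h h0 h1
    refine ⟨0, by simp, fun i hi => ?_⟩
    obtain rfl : i = 0 := by omega
    exact base _ _ h1
  | succ n ih =>
    intro w h h0 h1
    obtain ⟨v, hv, hvi⟩ := ih (fun i => w (i + 1)) (h / 2) (by positivity) (by linarith)
    rw [abs_lt] at hv
    obtain ⟨hv1, hv2⟩ := hv
    refine ⟨-sgb (w 1) * ((1 - sgb (w 0) * v) / 2), ?_, fun i hi => ?_⟩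
    · rw [abs_lt]
      cases w 0 <;> cases w 1 <;> simp [sgb] <;> constructor <;> linarith
    · rcases i with _ | i
      · exact base _ _ h1
      · rw [Function.iterate_succ_apply]
        have hstep : fpw (1/2) (-sgb (w 1) * ((1 - sgb (w 0) * v) / 2) * h, sgb (w 0) * (1 - h))
            = (v * (h / 2), sgb (w (0 + 1)) * (1 - h / 2)) := by
          have hp : 0 < (1 - v) / 2 * h := by apply mul_pos <;> linarith
          have hm : 0 < (1 + v) / 2 * h := by apply mul_pos <;> linarith
          unfold fpw
          simp only [zero_add]
          cases w 0 <;> cases w 1 <;> simp only [sgb] <;> norm_num <;> split_ifs <;>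
            first
            | (exfalso; linarith)
            | (ext <;> simp only <;> ring)
        rw [hstep]
        exact hvi i (by omega)

lemma netMaxcard_bound (n : ℕ) :
    ((2 ^ n : ℕ) : ℕ∞) ≤
      Dynamics.netMaxcard (fpw (1/2)) rhombus {p : (ℝ × ℝ) × (ℝ × ℝ) | dist p.1 p.2 < 1/2} n := by
  classical
  have hex : ∀ v : Fin n → Bool, ∃ p ∈ rhombus, ∀ i : Fin n,
      1/2 ≤ sgb (v i) * ((fpw (1/2))^[i] p).2 := by
    intro v
    let w : ℕ → Bool := fun i => if h : i < n then v ⟨i, h⟩ else true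
    obtain ⟨u, hu, hui⟩ := exists_itinerary n w (1/2) (by norm_num) le_rfl
    refine ⟨(u * (1/2), sgb (w 0) * (1 - 1/2)), ?_, fun i => ?_⟩
    · change |u * (1/2)| + |sgb (w 0) * (1 - 1/2)| ≤ 1
      have : |sgb (w 0)| = 1 := by cases w 0 <;> simp [sgb]
      rw [abs_mul, abs_mul, this]
      norm_num
      linarith
    · have := hui i i.2.le
      simpa [w] using this
  choose g hg hgi using hex
  have hsep : ∀ v v' : Fin n → Bool, ∀ z : ℝ × ℝ,
      (∀ k < n, dist ((fpw (1/2))^[k] (g v)) ((fpw (1/2))^[k] z) < 1/2) →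
      (∀ k < n, dist ((fpw (1/2))^[k] (g v')) ((fpw (1/2))^[k] z) < 1/2) → v = v' := by
    intro v v' z h h'
    funext i
    have h1 := h i i.2
    have h2 := h' i i.2
    have h3 := hgi v i
    have h4 := hgi v' i
    rw [Prod.dist_eq, max_lt_iff, Real.dist_eq, Real.dist_eq, abs_lt, abs_lt] at h1 h2
    obtain ⟨-, h1, h1'⟩ := h1
    obtain ⟨-, h2, h2'⟩ := h2
    cases hb : v i <;> cases hb' : v' i <;> simp only [hb, hb', sgb] at h3 h4 ⊢ <;> norm_num at h3 h4 <;> linarith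
  have hinj : Function.Injective g := by
    intro v v' h
    apply hsep v v' (g v)
    · intro k _; simp
    · intro k _; rw [h]; simp
  have hnet : Dynamics.IsDynNetIn (fpw (1/2)) rhombus
      {p : (ℝ × ℝ) × (ℝ × ℝ) | dist p.1 p.2 < 1/2} n
      ((Finset.univ.image g : Finset (ℝ × ℝ)) : Set (ℝ × ℝ)) := by
    constructor
    · intro p hp
      simp only [Finset.coe_image, Finset.coe_univ, image_univ, mem_range] at hp
      obtain ⟨v, rfl⟩ := hp
      exact hg v
    · intro p hp q hq hpq
      simp only [Finset.coe_image, Finset.coe_univ, image_univ, mem_range] at hp hq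
      obtain ⟨v, rfl⟩ := hp
      obtain ⟨v', rfl⟩ := hq
      rw [Function.onFun, Set.disjoint_left]
      intro z hz hz'
      apply hpq
      rw [Dynamics.mem_ball_dynEntourage] at hz hz'
      rw [hsep v v' z (fun k hk => hz k hk) (fun k hk => hz' k hk)]
  have := hnet.card_le_netMaxcard
  rw [Finset.card_image_of_injective _ hinj] at this
  simpa using this

lemma ennreal_log_two : ENNReal.log 2 = (Real.log 2 : EReal) := by
  rw [ENNReal.log_pos_real (by norm_num) (by norm_num)]
  simp

/-- The topological entropy of the midpoint map `f = f_{1/2}` on the rhombus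
`X` equals `log 2` (Bowen–Dinaburg entropy; in Mathlib, the cover entropy with respect to the
metric uniformity of the plane, which coincides with the uniformity of the ℓ¹ metric). -/
theorem entropy_fpw_half : Dynamics.coverEntropy (fpw (1/2)) rhombus = (Real.log 2 : EReal) := by
  rw [← ennreal_log_two, ← ExpGrowth.expGrowthSup_pow]
  apply le_antisymm
  · refine iSup₂_le fun U hU => ?_
    obtain ⟨C, hC⟩ := coverMincard_bound U hU
    refine ExpGrowth.expGrowthSup_le_of_eventually_le (b := (C : ENNReal)) (by simp)
      (Filter.Eventually.of_forall fun n => ?_)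
    have := ENat.toENNReal_mono (hC n)
    simpa using this
  · refine le_trans ?_ (Dynamics.netEntropyEntourage_le_coverEntropy (fpw (1/2)) rhombus
      (Metric.dist_mem_uniformity (show (0:ℝ) < 1/2 by norm_num)))
    refine ExpGrowth.expGrowthSup_monotone fun n => ?_
    have := ENat.toENNReal_mono (netMaxcard_bound n)
    simpa using this
end

section
/- For every t ∈ (0,1/2), the map f_t is strictly contracting on each of its four pieces, yet its topological entropy satisfies h(f_t) ≥ log 2 > 0. In particular there exists a piecewise affine, piecewise strictly contracting map of a compact two-dimensional region whose attractor is a two-point set and whose topological entropy is positive. -/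
/-- Points of the cones at `A` (`b = true`) and `B` (`b = false`). -/
noncomputable def conePt (b : Bool) (s u : ℝ) : ℝ × ℝ :=
  (s * u, if b then 1 - s else -(1 - s))

/-- Every transition between cones can be realised from the open cone. -/
lemma cone_step (t : ℝ) (b b' : Bool) (s u' : ℝ) (hs : 0 < s) (hs1 : s < 1)
    (h1 : -1 < u') (h2 : u' < 1) :
    ∃ u : ℝ, -1 < u ∧ u < 1 ∧ fpw t (conePt b s u) = conePt b' (t * s) u' := by
  cases b <;> cases b'
  · refine ⟨(u' + 1) / 2, by linarith, by linarith, ?_⟩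
    have hx : ¬ (s * ((u' + 1) / 2) ≤ 0) := not_le.2 (mul_pos hs (by linarith))
    have hy : ¬ (0 ≤ -(1 - s)) := by linarith
    simp only [fpw, conePt, Bool.false_eq_true, if_false, hx, hy]
    ext <;> simp <;> ring
  · refine ⟨(-u' - 1) / 2, by linarith, by linarith, ?_⟩
    have hx : s * ((-u' - 1) / 2) ≤ 0 :=
      mul_nonpos_of_nonneg_of_nonpos hs.le (by linarith)
    have hy : ¬ (0 ≤ -(1 - s)) := by linarith
    simp only [fpw, conePt, Bool.false_eq_true, if_false, hx, hy, if_true]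
    ext <;> simp <;> ring
  · refine ⟨(1 - u') / 2, by linarith, by linarith, ?_⟩
    have hx : ¬ (s * ((1 - u') / 2) ≤ 0) := not_le.2 (mul_pos hs (by linarith))
    have hy : 0 ≤ 1 - s := by linarith
    simp only [fpw, conePt, Bool.false_eq_true, if_false, hx, hy, if_true]
    ext <;> simp <;> ring
  · refine ⟨(u' - 1) / 2, by linarith, by linarith, ?_⟩
    have hx : s * ((u' - 1) / 2) ≤ 0 :=
      mul_nonpos_of_nonneg_of_nonpos hs.le (by linarith)
    have hy : 0 ≤ 1 - s := by linarith
    simp only [fpw, conePt, hx, hy, if_true]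
    ext <;> simp <;> ring

/-- Every itinerary is realised. -/
lemma cone_itinerary (t : ℝ) (ht0 : 0 < t) (ht : t < 1/2) (n : ℕ) :
    ∀ (w : ℕ → Bool) (s : ℝ), 0 < s → s ≤ 1/2 →
      ∃ u : ℝ, -1 < u ∧ u < 1 ∧ ∀ i < n,
        (w i = true → 1/2 ≤ ((fpw t)^[i] (conePt (w 0) s u)).2) ∧
        (w i = false → ((fpw t)^[i] (conePt (w 0) s u)).2 ≤ -(1/2)) := by
  induction n with
  | zero => intro w s _ _; exact ⟨0, by norm_num, by norm_num, by simp⟩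
  | succ n ih =>
    intro w s hs hs1
    obtain ⟨u', h1, h2, h⟩ := ih (fun i => w (i + 1)) (t * s) (by positivity) (by nlinarith)
    obtain ⟨u, g1, g2, g⟩ := cone_step t (w 0) (w 1) s u' hs (by linarith) h1 h2
    refine ⟨u, g1, g2, ?_⟩
    intro i hi
    cases i with
    | zero =>
      constructor
      · intro hw
        simp [conePt, hw]; linarith
      · intro hw
        simp [conePt, hw]; linarith
    | succ i =>
      rw [Function.iterate_succ_apply, g]
      exact h i (by omega)

lemma cone_mem (b : Bool) (u : ℝ) (h1 : -1 < u) (h2 : u < 1) :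
    conePt b (1/2) u ∈ rhombus := by
  have : |u| ≤ 1 := abs_le.2 ⟨h1.le, h2.le⟩
  have e : |(1/2 : ℝ) * u| ≤ 1/2 := by rw [abs_mul, abs_of_pos (by norm_num)]; linarith
  cases b
  · have : |(-(1 - 1/2) : ℝ)| = 1/2 := by norm_num [abs_of_neg, abs_of_pos]
    simp only [rhombus, conePt, Set.mem_ofPred_eq, Bool.false_eq_true, if_false, this]
    linarith
  · have : |(1 - 1/2 : ℝ)| = 1/2 := by norm_num [abs_of_pos]
    simp only [rhombus, conePt, Set.mem_ofPred_eq, if_true, this]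
    linarith

lemma net_card (t : ℝ) (ht0 : 0 < t) (ht : t < 1/2) (n : ℕ) :
    ((2 ^ n : ℕ) : ℕ∞) ≤
      Dynamics.netMaxcard (fpw t) rhombus {p : (ℝ × ℝ) × (ℝ × ℝ) | dist p.1 p.2 < 1/2} n := by
  classical
  have key : ∀ w : Fin n → Bool, ∃ p ∈ rhombus, ∀ i : Fin n,
      (w i = true → 1/2 ≤ ((fpw t)^[i] p).2) ∧ (w i = false → ((fpw t)^[i] p).2 ≤ -(1/2)) := by
    intro w
    obtain ⟨u, h1, h2, h⟩ := cone_itinerary t ht0 ht n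
      (fun i => if hi : i < n then w ⟨i, hi⟩ else true) (1/2) (by norm_num) le_rfl
    refine ⟨_, cone_mem (if hi : 0 < n then w ⟨0, hi⟩ else true) u h1 h2, fun i => ?_⟩
    have := h i i.2
    have e : (if hi : (i : ℕ) < n then w ⟨i, hi⟩ else true) = w i := dif_pos i.2
    rw [e] at this
    exact this
  choose P hP hw using key
  have sep : ∀ w v, w ≠ v → ∃ i < n, 1 ≤ dist ((fpw t)^[i] (P w)) ((fpw t)^[i] (P v)) := by
    intro w v hne
    obtain ⟨i, hi⟩ := Function.ne_iff.1 hne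
    refine ⟨i, i.2, ?_⟩
    refine le_trans ?_ (le_max_right _ _)
    rw [Real.dist_eq]
    have a := hw w i
    have b := hw v i
    cases hwi : w i <;> cases hvi : v i
    · simp [hwi, hvi] at hi
    · have a' := a.2 hwi
      have b' := b.1 hvi
      rw [abs_sub_comm]
      exact le_trans (by linarith) (le_abs_self _)
    · have a' := a.1 hwi
      have b' := b.2 hvi
      exact le_trans (by linarith) (le_abs_self _)
    · simp [hwi, hvi] at hi
  have inj : Function.Injective P := by
    intro w v h
    by_contra hne
    obtain ⟨i, _, hi⟩ := sep w v hne
    rw [h, dist_self] at hi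
    linarith
  have hnet : Dynamics.IsDynNetIn (fpw t) rhombus
      {p : (ℝ × ℝ) × (ℝ × ℝ) | dist p.1 p.2 < 1/2} n
      ((Finset.univ.image P : Finset (ℝ × ℝ)) : Set (ℝ × ℝ)) := by
    constructor
    · intro p hp
      simp only [Finset.coe_image, Finset.coe_univ, Set.image_univ, Set.mem_range] at hp
      obtain ⟨w, rfl⟩ := hp
      exact hP w
    · intro p hp q hq hpq
      simp only [Finset.coe_image, Finset.coe_univ, Set.image_univ, Set.mem_range] at hp hq
      obtain ⟨w, rfl⟩ := hp
      obtain ⟨v, rfl⟩ := hq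
      obtain ⟨i, hin, hi⟩ := sep w v (fun h => hpq (by rw [h]))
      refine Set.disjoint_left.2 fun z hz1 hz2 => ?_
      have e1 := (Dynamics.mem_ball_dynEntourage.1 hz1) i hin
      have e2 := (Dynamics.mem_ball_dynEntourage.1 hz2) i hin
      simp only [UniformSpace.ball, Set.mem_preimage, Set.mem_ofPred_eq] at e1 e2
      have := dist_triangle_right ((fpw t)^[i] (P w)) ((fpw t)^[i] (P v)) ((fpw t)^[i] z)
      linarith
  have := hnet.card_le_netMaxcard
  rw [Finset.card_image_of_injective _ inj] at this
  simpa using this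

lemma abs_aux (t a b : ℝ) (ht0 : 0 < t) :
    |2 * t * a - t * b| + |t * b| ≤ 2 * t * (|a| + |b|) ∧
    |2 * t * a + t * b| + |t * b| ≤ 2 * t * (|a| + |b|) := by
  have h1 := abs_sub (2 * t * a) (t * b)
  have h2 := abs_add_le (2 * t * a) (t * b)
  have e1 : |2 * t * a| = 2 * t * |a| := by rw [abs_mul, abs_of_pos (by positivity)]
  have e2 : |t * b| = t * |b| := by rw [abs_mul, abs_of_pos ht0]
  rw [e1, e2] at h1 h2
  rw [e2]
  constructor <;> nlinarith

/-- For every `t ∈ (0,1/2)`, the map `f_t` is strictly contracting on each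
of its four pieces (there is a constant `c < 1` with `d(f_t p, f_t q) ≤ c · d(p,q)` for `p,q`
in the same piece), yet its topological entropy satisfies `h(f_t) ≥ log 2 > 0`. -/
theorem strict_contraction_positive_entropy (t : ℝ) (ht0 : 0 < t) (ht : t < 1/2) :
    (∃ c : ℝ, c < 1 ∧ ∀ p q : ℝ × ℝ, samePiece p q →
      l1dist (fpw t p) (fpw t q) ≤ c * l1dist p q) ∧
    (Real.log 2 : EReal) ≤ Dynamics.coverEntropy (fpw t) rhombus ∧
    (0 : EReal) < (Real.log 2 : EReal) := by
  refine ⟨⟨2 * t, by linarith, ?_⟩, ?_, ?_⟩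
  · rintro ⟨x, y⟩ ⟨x', y'⟩ ⟨h1, h2⟩
    simp only at h1 h2
    obtain ⟨A, B⟩ := abs_aux t (x - x') (y - y') ht0
    have C : |t * (y - y')| = |-(t * (y - y'))| := (abs_neg _).symm
    have A' := A
    have B' := B
    rw [← abs_neg (2 * t * (x - x') - t * (y - y'))] at A'
    rw [← abs_neg (2 * t * (x - x') + t * (y - y'))] at B'
    by_cases hx : x ≤ 0 <;> by_cases hy : 0 ≤ y
    · simp only [l1dist, fpw, hx, hy, h1.1 hx, h2.1 hy, if_true]
      convert A using 3 <;> ring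
    · simp only [l1dist, fpw, hx, hy, h1.1 hx, mt h2.2 hy, if_true, if_false]
      rw [C] at B'
      convert B' using 3 <;> ring
    · simp only [l1dist, fpw, hx, hy, mt h1.2 hx, h2.1 hy, if_true, if_false]
      rw [C] at B'
      convert B' using 3 <;> ring
    · simp only [l1dist, fpw, hx, hy, mt h1.2 hx, mt h2.2 hy, if_false]
      convert A using 3 <;> ring
  · refine le_trans ?_ (Dynamics.netEntropyEntourage_le_coverEntropy (fpw t) rhombus
      (Metric.dist_mem_uniformity (show (0 : ℝ) < 1/2 by norm_num)))
    have h : ExpGrowth.expGrowthSup (fun n => (2 : ENNReal) ^ n) = ((Real.log 2 : ℝ) : EReal) := by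
      rw [ExpGrowth.expGrowthSup_pow, ENNReal.log_pos_real (by norm_num) (by norm_num)]
      simp
    rw [← h]
    refine ExpGrowth.expGrowthSup_monotone fun n => ?_
    have := ENat.toENNReal_mono (net_card t ht0 ht n)
    simpa using this
  · exact_mod_cast Real.log_pos (by norm_num : (1 : ℝ) < 2)
end

section
/- Let X ⊆ ℝ^d be a nonempty compact set (with the Euclidean metric), let P_1, …, P_k be finitely many pairwise disjoint convex sets whose union is X, and let f : X → X be a map such that for each i there is an affine map A_i : ℝ^d → ℝ^d agreeing with f on P_i whose linear part L_i is a conformal non-strict contraction, i.e. there is a constant c_i ≤ 1 with ‖L_i v‖ = c_i·‖v‖ for all v ∈ ℝ^d. Then the topological entropy of f is zero: h(f) = 0. -/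
namespace PAC

/-- Symbols: sign vectors. -/
abbrev Sym (ι : Type) := ι → SignType

/-- Strategies: a symbol for each finite history (in chronological order). -/
abbrev Strat (ι : Type) := List (Sym ι) → Sym ι

/-- The strategy after one move. -/
def next {ι : Type} (σ : Strat ι) : Strat ι := fun h => σ (σ [] :: h)

/-- The word of length `n` generated by a strategy. -/
def word {ι : Type} : ℕ → Strat ι → List (Sym ι)
  | 0, _ => []
  | n + 1, σ => σ [] :: word n (next σ)

lemma word_length {ι : Type} (n : ℕ) (σ : Strat ι) : (word n σ).length = n := by
  induction n generalizing σ with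
  | zero => rfl
  | succ n ih => simp [word, ih]

lemma word_congr {ι : Type} (n : ℕ) (σ τ : Strat ι) (h : ∀ l : List (Sym ι), l.length < n → σ l = τ l) :
    word n σ = word n τ := by
  induction n generalizing σ τ with
  | zero => rfl
  | succ n ih =>
    have h0 : σ [] = τ [] := h [] (by simp)
    simp only [word, h0]
    congr 1
    apply ih
    intro l hl
    simp only [next, h0]
    exact h _ (by simpa using hl)

lemma word_add {ι : Type} (n m : ℕ) (σ : Strat ι) :
    word (n + m) σ = word n σ ++ word m (next^[n] σ) := by
  induction n generalizing σ with
  | zero => simp [word]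
  | succ n ih =>
    rw [show n + 1 + m = (n + m) + 1 by ring]
    simp [word, ih]

lemma word_take {ι : Type} (n m : ℕ) (h : n ≤ m) (σ : Strat ι) :
    word n σ = (word m σ).take n := by
  obtain ⟨k, rfl⟩ := Nat.exists_eq_add_of_le h
  rw [word_add, List.take_left' (word_length n σ)]

lemma words_finite {ι : Type} [Finite ι] (n : ℕ) (D : Set (Strat ι)) : (word n '' D).Finite := by
  apply (List.finite_length_eq (Sym ι) n).subset
  rintro _ ⟨σ, -, rfl⟩
  exact word_length n σ

lemma step_iter {ι : Type} (𝒟 : Set (Set (Strat ι)))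
    (hstep : ∀ D ∈ 𝒟, ∀ e, next '' {σ ∈ D | σ [] = e} ∈ 𝒟) (n : ℕ) :
    ∀ D ∈ 𝒟, ∀ l : List (Sym ι), l.length = n → next^[n] '' {σ ∈ D | word n σ = l} ∈ 𝒟 := by
  induction n with
  | zero =>
    intro D hD l hl
    have : l = [] := List.length_eq_zero_iff.1 hl
    subst this
    simpa [word] using hD
  | succ n ih =>
    intro D hD l hl
    match l, hl with
    | e :: l, hl =>
      have := ih _ (hstep D hD e) l (by simpa using hl)
      convert this using 1
      ext τ
      constructor
      · rintro ⟨σ, ⟨hσ, hw⟩, rfl⟩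
        simp only [word, List.cons.injEq] at hw
        exact ⟨next σ, ⟨⟨σ, ⟨hσ, hw.1⟩, rfl⟩, hw.2⟩, rfl⟩
      · rintro ⟨_, ⟨⟨σ, ⟨hσ, h1⟩, rfl⟩, h2⟩, rfl⟩
        exact ⟨σ, ⟨hσ, by simp [word, h1, h2]⟩, rfl⟩

lemma submult {ι : Type} [Finite ι] (𝒟 : Set (Set (Strat ι)))
    (hstep : ∀ D ∈ 𝒟, ∀ e, next '' {σ ∈ D | σ [] = e} ∈ 𝒟) (n M : ℕ)
    (hM : ∀ D ∈ 𝒟, (word n '' D).ncard ≤ M) (k : ℕ) :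
    ∀ D ∈ 𝒟, (word (k * n) '' D).ncard ≤ M ^ k := by
  classical
  induction k with
  | zero =>
    intro D hD
    have : word (0 * n) '' D ⊆ {[]} := by
      rintro _ ⟨σ, -, rfl⟩
      simp [word]
    simpa using Set.ncard_le_ncard this
  | succ k ih =>
    intro D hD
    set H := (words_finite n D).toFinset with hH
    let W : List (Sym ι) → Finset (List (Sym ι)) := fun l =>
      ((words_finite (k * n) (next^[n] '' {σ ∈ D | word n σ = l})).toFinset).image (fun m => l ++ m)
    have hsub : word ((k + 1) * n) '' D ⊆ (H.biUnion W : Finset _) := by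
      rintro _ ⟨σ, hσ, rfl⟩
      rw [Finset.mem_coe, Finset.mem_biUnion]
      refine ⟨word n σ, by simp only [hH, Set.Finite.mem_toFinset]; exact ⟨σ, hσ, rfl⟩, ?_⟩
      simp only [W, Finset.mem_image, Set.Finite.mem_toFinset]
      refine ⟨word (k * n) (next^[n] σ), ⟨_, ⟨σ, ⟨hσ, rfl⟩, rfl⟩, rfl⟩, ?_⟩
      rw [← word_add]; congr 1; ring
    calc (word ((k + 1) * n) '' D).ncard ≤ ((H.biUnion W : Finset _) : Set (List (Sym ι))).ncard :=
          Set.ncard_le_ncard hsub (Finset.finite_toSet _)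
      _ = (H.biUnion W).card := Set.ncard_coe_finset _
      _ ≤ H.card * M ^ k := by
          apply Finset.card_biUnion_le_card_mul
          intro l hl
          have hl' : l ∈ word n '' D := by simpa [hH] using hl
          obtain ⟨σ, -, rfl⟩ := hl'
          refine Finset.card_image_le.trans ?_
          rw [← Set.ncard_eq_toFinset_card _ (words_finite _ _)]
          exact ih _ (step_iter 𝒟 hstep n D hD _ (word_length n σ))
      _ ≤ M * M ^ k := by
          gcongr
          rw [hH, ← Set.ncard_eq_toFinset_card _ (words_finite _ _)]
          exact hM D hD
      _ = M ^ (k + 1) := by ring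

lemma growth {ι : Type} [Finite ι] (𝒟 : Set (Set (Strat ι)))
    (hstep : ∀ D ∈ 𝒟, ∀ e, next '' {σ ∈ D | σ [] = e} ∈ 𝒟) (n₀ : ℕ) (hn₀ : 0 < n₀)
    (δ : ℝ) (hδ : 0 ≤ δ)
    (hM : ∀ D ∈ 𝒟, ((word n₀ '' D).ncard : ℝ) ≤ Real.exp (δ * n₀)) :
    ∀ D ∈ 𝒟, ∀ n : ℕ, ((word n '' D).ncard : ℝ) ≤ Real.exp (δ * n₀) * Real.exp (δ * n) := by
  intro D hD n
  set k := n / n₀ + 1 with hk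
  have h1 : n ≤ k * n₀ := by
    have := Nat.div_add_mod n n₀
    have := Nat.mod_lt n hn₀
    rw [hk]; nlinarith
  have h2 : k * n₀ ≤ n + n₀ := by
    have := Nat.div_mul_le_self n n₀
    rw [hk]; nlinarith
  have h3 := submult 𝒟 hstep n₀ ⌊Real.exp (δ * n₀)⌋₊ (fun D hD => Nat.le_floor (hM D hD)) k D hD
  have h4 : (word n '' D).ncard ≤ (word (k * n₀) '' D).ncard := by
    have : word n '' D = (fun l => l.take n) '' (word (k * n₀) '' D) := by
      rw [Set.image_image]
      apply Set.image_congr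
      intro σ _
      exact word_take n _ h1 σ
    rw [this]
    exact Set.ncard_image_le (words_finite _ _)
  calc ((word n '' D).ncard : ℝ) ≤ ((⌊Real.exp (δ * n₀)⌋₊ ^ k : ℕ) : ℝ) := by
        exact_mod_cast h4.trans h3
    _ = (⌊Real.exp (δ * n₀)⌋₊ : ℝ) ^ k := by push_cast; rfl
    _ ≤ Real.exp (δ * n₀) ^ k := by
        gcongr
        exact Nat.floor_le (Real.exp_pos _).le
    _ = Real.exp (δ * ((k * n₀ : ℕ) : ℝ)) := by
        rw [← Real.exp_nat_mul]; congr 1; push_cast; ring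
    _ ≤ Real.exp (δ * ((n + n₀ : ℕ) : ℝ)) := by
        gcongr
    _ = Real.exp (δ * n₀) * Real.exp (δ * n) := by
        rw [← Real.exp_add]; congr 1; push_cast; ring

lemma exists_time (C δ : ℝ) (hδ : 0 < δ) :
    ∃ n₀ : ℕ, 0 < n₀ ∧ C * Real.exp (δ / 2 * n₀) ≤ Real.exp (δ * n₀) := by
  obtain ⟨n, hn⟩ := exists_nat_gt (2 / δ * C)
  refine ⟨n + 1, Nat.succ_pos n, ?_⟩
  have h1 : C ≤ Real.exp (δ / 2 * ((n + 1 : ℕ) : ℝ)) := by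
    have h2 := Real.add_one_le_exp (δ / 2 * ((n + 1 : ℕ) : ℝ))
    have h3 : C ≤ δ / 2 * n := by
      have : δ / 2 * (2 / δ * C) ≤ δ / 2 * n := by gcongr
      have h5 : δ / 2 * (2 / δ * C) = C := by field_simp
      linarith
    push_cast at h2 ⊢
    linarith
  calc C * Real.exp (δ / 2 * ((n + 1 : ℕ) : ℝ))
      ≤ Real.exp (δ / 2 * ((n + 1 : ℕ) : ℝ)) * Real.exp (δ / 2 * ((n + 1 : ℕ) : ℝ)) := by gcongr
    _ = Real.exp (δ * ((n + 1 : ℕ) : ℝ)) := by rw [← Real.exp_add]; congr 1; ring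

/-- Composition of the linear maps along a history. -/
def Lh {ι : Type} {V : Type} [AddCommGroup V] [Module ℝ V] (L : Sym ι → V →ₗ[ℝ] V) :
    List (Sym ι) → V →ₗ[ℝ] V
  | [] => LinearMap.id
  | e :: h => Lh L h ∘ₗ L e

/-- Refinement of a strategy by a vector: undecided signs are decided by the vector. -/
noncomputable def refn {ι : Type} {V : Type} [AddCommGroup V] [Module ℝ V]
    (a : ι → V →ₗ[ℝ] ℝ) (L : Sym ι → V →ₗ[ℝ] V) (σ : Strat ι) (w : V) : Strat ι :=
  fun h j => if σ h j = 0 then SignType.sign (a j (Lh L h w)) else σ h j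

/-- Undecided signs are blind to `U`. -/
def Kills {ι : Type} {V : Type} [AddCommGroup V] [Module ℝ V]
    (a : ι → V →ₗ[ℝ] ℝ) (L : Sym ι → V →ₗ[ℝ] V) (σ : Strat ι) (U : Submodule ℝ V) : Prop :=
  ∀ h j, σ h j = 0 → ∀ u ∈ U, a j (Lh L h u) = 0

section lin
variable {ι : Type} {V : Type} [NormedAddCommGroup V] [InnerProductSpace ℝ V]
  (a : ι → V →ₗ[ℝ] ℝ) (L : Sym ι → V →ₗ[ℝ] V)

lemma next_refn (σ : Strat ι) (w : V) (e : Sym ι) (he : refn a L σ w [] = e) :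
    next (refn a L σ w) = refn a L (fun h => σ (e :: h)) (L e w) := by
  funext h j
  simp [next, he, refn, Lh]

lemma refn_smul (σ : Strat ι) (w : V) (t : ℝ) (ht : 0 < t) :
    refn a L σ (t • w) = refn a L σ w := by
  funext h j
  simp [refn, sign_mul, sign_pos ht]

lemma refn_add_of_kills (σ : Strat ι) (U : Submodule ℝ V) (hU : Kills a L σ U) (u w : V)
    (hu : u ∈ U) : refn a L σ (u + w) = refn a L σ w := by
  funext h j
  by_cases h0 : σ h j = 0
  · simp [refn, h0, hU h j h0 u hu]
  · simp [refn, h0]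

lemma kills_refn (σ : Strat ι) (U : Submodule ℝ V) (hU : Kills a L σ U) (w : V) :
    Kills a L (refn a L σ w) (U ⊔ Submodule.span ℝ {w}) := by
  intro h j h0 x hx
  obtain ⟨u, hu, y, hy, rfl⟩ := Submodule.mem_sup.1 hx
  obtain ⟨t, rfl⟩ := Submodule.mem_span_singleton.1 hy
  have h1 : σ h j = 0 := by
    by_contra hne
    simp [refn, hne] at h0
  have h2 : a j (Lh L h w) = 0 := by
    simpa [refn, h1, sign_eq_zero_iff] using h0
  simp [hU h j h1 u hu, h2]

lemma kills_next (σ : Strat ι) (U : Submodule ℝ V) (hU : Kills a L σ U) (e : Sym ι) :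
    Kills a L (fun h => σ (e :: h)) (U.map (L e)) := by
  rintro h j h0 _ ⟨u, hu, rfl⟩
  simpa [Lh] using hU (e :: h) j h0 u hu

/-- Local conicity: a radius on which the `n`-words near `w₀` are those of the refined strategy. -/
lemma local_radius [Finite ι] [FiniteDimensional ℝ V] (n : ℕ) (w₀ : V) :
    ∃ ρ > 0, ∀ w ∈ Metric.ball w₀ ρ, ∀ σ : Strat ι,
      word n (refn a L σ w) = word n (refn a L (refn a L σ w₀) (w - w₀)) := by
  have hev : ∀ᶠ w in nhds w₀, ∀ h ∈ {h : List (Sym ι) | h.length < n}, ∀ j,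
      a j (Lh L h w₀) ≠ 0 →
        SignType.sign (a j (Lh L h w)) = SignType.sign (a j (Lh L h w₀)) := by
    rw [Filter.eventually_all_finite (List.finite_length_lt (Sym ι) n)]
    intro h _
    rw [Filter.eventually_all]
    intro j
    by_cases h0 : a j (Lh L h w₀) = 0
    · simp [h0]
    · have hc : Continuous (fun w => a j (Lh L h w)) :=
        (a j ∘ₗ Lh L h).continuous_of_finiteDimensional
      rcases lt_or_gt_of_ne h0 with h1 | h1
      · filter_upwards [hc.continuousAt.eventually (gt_mem_nhds h1)] with w hw _
        rw [sign_neg hw, sign_neg h1]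
      · filter_upwards [hc.continuousAt.eventually (lt_mem_nhds h1)] with w hw _
        rw [sign_pos hw, sign_pos h1]
  obtain ⟨ρ, hρ, hball⟩ := Metric.eventually_nhds_iff_ball.1 hev
  refine ⟨ρ, hρ, fun w hw σ => word_congr n _ _ fun h hh => ?_⟩
  funext j
  have := hball w hw h hh j
  by_cases h0 : σ h j = 0
  · by_cases h1 : a j (Lh L h w₀) = 0
    · simp [refn, h0, h1]
    · simp [refn, h0, h1, this h1]
  · simp [refn, h0]


lemma inner_L
    (c : Sym ι → ℝ) (hL : ∀ e v, ‖L e v‖ = c e * ‖v‖) (e : Sym ι) (u w : V) (h : inner ℝ u w = 0) : inner ℝ (L e u) (L e w) = 0 := by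
  rw [real_inner_eq_norm_add_mul_self_sub_norm_mul_self_sub_norm_mul_self_div_two] at h ⊢
  rw [← map_add, hL, hL, hL]
  have : ‖u + w‖ * ‖u + w‖ - ‖u‖ * ‖u‖ - ‖w‖ * ‖w‖ = 0 := by linarith
  linear_combination (c e ^ 2 / 2) * this

/-- The families of strategies to which the growth lemma is applied. -/
def fam (p : ℕ) (r : ℝ) : Set (Set (Strat ι)) :=
  {D | D.Subsingleton ∨ ∃ (σ : Strat ι) (U : Submodule ℝ V) (s : ℝ) (E : Set V),
    Kills a L σ U ∧ Module.finrank ℝ V ≤ Module.finrank ℝ U + p ∧ 0 < s ∧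
    (∀ w ∈ E, ‖w‖ = s ∧ ∀ u ∈ U, inner ℝ u w = 0) ∧
    (∀ w ∈ E, ∀ w' ∈ E, dist w w' < s * r) ∧ D = refn a L σ '' E}

lemma fam_step
    (c : Sym ι → ℝ) (hL : ∀ e v, ‖L e v‖ = c e * ‖v‖) (hc : ∀ e, 0 ≤ c e) (p : ℕ) (r : ℝ) :
    ∀ D ∈ fam a L p r, ∀ e, next '' {σ ∈ D | σ [] = e} ∈ fam a L p r := by
  rintro D (hD | ⟨σ, U, s, E, hk, hd, hs, hE, hr, rfl⟩) e
  · left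
    exact (hD.anti (Set.sep_subset _ _)).image _
  · rcases (hc e).eq_or_lt with h0 | hpos
    · left
      rintro _ ⟨_, ⟨⟨w, hw, rfl⟩, he⟩, rfl⟩ _ ⟨_, ⟨⟨w', hw', rfl⟩, he'⟩, rfl⟩
      rw [next_refn a L σ w e he, next_refn a L σ w' e he']
      have hz : ∀ v, L e v = 0 := fun v => by
        rw [← norm_eq_zero, hL, ← h0, zero_mul]
      rw [hz, hz]
    · right
      have hinj : Function.Injective (L e) := by
        rw [injective_iff_map_eq_zero]
        intro v hv
        have := hL e v
        rw [hv, norm_zero] at this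
        rcases mul_eq_zero.1 this.symm with h | h
        · exact absurd h hpos.ne'
        · exact norm_eq_zero.1 h
      refine ⟨fun h => σ (e :: h), U.map (L e), c e * s, L e '' {w ∈ E | refn a L σ w [] = e},
        kills_next a L σ U hk e, ?_, mul_pos hpos hs, ?_, ?_, ?_⟩
      · rwa [← (Submodule.equivMapOfInjective (L e) hinj U).finrank_eq]
      · rintro _ ⟨w, ⟨hw, -⟩, rfl⟩
        refine ⟨by rw [hL, (hE w hw).1], ?_⟩
        rintro _ ⟨u, hu, rfl⟩
        exact inner_L L c hL e u w ((hE w hw).2 u hu)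
      · rintro _ ⟨w, ⟨hw, -⟩, rfl⟩ _ ⟨w', ⟨hw', -⟩, rfl⟩
        rw [dist_eq_norm, ← map_sub, hL, mul_assoc, ← dist_eq_norm]
        exact mul_lt_mul_of_pos_left (hr w hw w' hw') hpos
      · ext τ
        constructor
        · rintro ⟨_, ⟨⟨w, hw, rfl⟩, he⟩, rfl⟩
          exact ⟨L e w, ⟨w, ⟨hw, he⟩, rfl⟩, (next_refn a L σ w e he).symm⟩
        · rintro ⟨_, ⟨w, ⟨hw, he⟩, rfl⟩, rfl⟩
          exact ⟨_, ⟨⟨w, hw, rfl⟩, he⟩, next_refn a L σ w e he⟩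

/-- Subexponential growth of linear words. -/
theorem linear_growth
    (c : Sym ι → ℝ) (hL : ∀ e v, ‖L e v‖ = c e * ‖v‖) [Finite ι] [FiniteDimensional ℝ V] (hc : ∀ e, 0 ≤ c e) (p : ℕ) :
    ∀ δ > 0, ∃ C : ℝ, ∀ U : Submodule ℝ V, Module.finrank ℝ V ≤ Module.finrank ℝ U + p →
      ∀ σ : Strat ι, Kills a L σ U → ∀ n : ℕ,
        ((word n '' Set.range (refn a L σ)).ncard : ℝ) ≤ C * Real.exp (δ * n) := by
  induction p with
  | zero =>
    intro δ hδ
    refine ⟨1, fun U hU σ hk n => ?_⟩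
    have hUtop : U = ⊤ := Submodule.eq_top_of_finrank_eq
      (le_antisymm (Submodule.finrank_le U) (by simpa using hU))
    have hsub : word n '' Set.range (refn a L σ) ⊆ {word n (refn a L σ 0)} := by
      rintro _ ⟨_, ⟨w, rfl⟩, rfl⟩
      have := refn_add_of_kills a L σ U hk w 0 (by simp [hUtop])
      simp only [add_zero] at this
      simp [this]
    have h1 := Set.ncard_le_ncard hsub
    rw [Set.ncard_singleton] at h1
    have h2 : (1 : ℝ) ≤ Real.exp (δ * n) := Real.one_le_exp (by positivity)
    have h3 : ((word n '' Set.range (refn a L σ)).ncard : ℝ) ≤ 1 := by exact_mod_cast h1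
    linarith
  | succ p ih =>
    intro δ hδ
    obtain ⟨C, hC⟩ := ih (δ / 2) (by positivity)
    obtain ⟨n₀, hn₀, hCn⟩ := exists_time C δ hδ
    choose ρ hρ hloc using local_radius a L n₀
    have hcomp : IsCompact (Metric.sphere (0 : V) 1) := isCompact_sphere 0 1
    obtain ⟨r, hr, hleb⟩ := lebesgue_number_lemma_of_metric (c := fun w₀ : Metric.sphere (0 : V) 1 =>
      Metric.ball (w₀ : V) (min (ρ w₀) (1 / 2))) hcomp (fun _ => Metric.isOpen_ball) (by
        intro w hw
        exact Set.mem_iUnion.2 ⟨⟨w, hw⟩, Metric.mem_ball_self (lt_min (hρ w) (by norm_num))⟩)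
    have hexp1 : (1 : ℝ) ≤ Real.exp (δ * n₀) := Real.one_le_exp (by positivity)
    have hM : ∀ D ∈ fam a L (p + 1) r, ((word n₀ '' D).ncard : ℝ) ≤ Real.exp (δ * n₀) := by
      rintro D (hD | ⟨σ, U, s, E, hk, hd, hs, hE, hEr, rfl⟩)
      · have h1 : (word n₀ '' D).ncard ≤ 1 := by
          rw [Set.ncard_le_one (words_finite _ _)]
          intro x hx y hy
          exact (hD.image _) hx hy
        have : ((word n₀ '' D).ncard : ℝ) ≤ 1 := by exact_mod_cast h1
        linarith
      · rcases E.eq_empty_or_nonempty with rfl | ⟨w₁, hw₁⟩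
        · simp; positivity
        have hsph : ∀ w ∈ E, s⁻¹ • w ∈ Metric.sphere (0 : V) 1 := by
          intro w hw
          rw [mem_sphere_zero_iff_norm, norm_smul, (hE w hw).1, norm_inv, Real.norm_of_nonneg hs.le]
          field_simp
        obtain ⟨⟨w₀, hw₀⟩, hball⟩ := hleb (s⁻¹ • w₁) (hsph w₁ hw₁)
        simp only at hball
        have hin : ∀ w ∈ E, s⁻¹ • w ∈ Metric.ball w₀ (min (ρ w₀) (1 / 2)) := by
          intro w hw
          apply hball
          rw [Metric.mem_ball, dist_smul₀, norm_inv, Real.norm_of_nonneg hs.le]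
          have := hEr w hw w₁ hw₁
          rw [inv_mul_lt_iff₀ hs]
          exact this
        have hnot : w₀ ∉ U := by
          intro hmem
          have h1 := hin w₁ hw₁
          have h2 : dist (s⁻¹ • w₁) w₀ < 1 / 2 := lt_of_lt_of_le h1 (min_le_right _ _)
          have h3 : inner ℝ w₀ (s⁻¹ • w₁) = 0 := by
            rw [inner_smul_right, (hE w₁ hw₁).2 w₀ hmem, mul_zero]
          rw [dist_comm, dist_eq_norm] at h2
          have h4 := norm_sub_sq_eq_norm_sq_add_norm_sq_real h3
          rw [mem_sphere_zero_iff_norm.1 hw₀, mem_sphere_zero_iff_norm.1 (hsph w₁ hw₁)] at h4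
          nlinarith [norm_nonneg (w₀ - s⁻¹ • w₁)]
        have hdim : Module.finrank ℝ V ≤
            Module.finrank ℝ (U ⊔ Submodule.span ℝ {w₀} : Submodule ℝ V) + p := by
          have : U < U ⊔ Submodule.span ℝ {w₀} := by
            refine lt_of_le_of_ne le_sup_left fun h => hnot ?_
            rw [h]
            exact Submodule.mem_sup_right (Submodule.mem_span_singleton_self w₀)
          have := Submodule.finrank_lt_finrank_of_lt this
          omega
        have hcount := hC _ hdim _ (kills_refn a L σ U hk w₀) n₀
        have hsub : word n₀ '' (refn a L σ '' E) ⊆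
            word n₀ '' Set.range (refn a L (refn a L σ w₀)) := by
          rintro _ ⟨_, ⟨w, hw, rfl⟩, rfl⟩
          refine ⟨_, ⟨s⁻¹ • w - w₀, rfl⟩, ?_⟩
          rw [← hloc w₀ (s⁻¹ • w) (Metric.ball_subset_ball (min_le_left _ _) (hin w hw)),
            refn_smul a L σ w _ (by positivity)]
        have h5 : ((word n₀ '' (refn a L σ '' E)).ncard : ℝ) ≤
            ((word n₀ '' Set.range (refn a L (refn a L σ w₀))).ncard : ℝ) := by
          exact_mod_cast Set.ncard_le_ncard hsub (words_finite _ _)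
        linarith
    have hg := growth (fam a L (p + 1) r) (fam_step a L c hL hc (p + 1) r) n₀ hn₀ δ hδ.le hM
    obtain ⟨t, -, htfin, htcov⟩ := hcomp.finite_cover_balls (e := r / 2) (by positivity)
    lift t to Finset V using htfin
    refine ⟨(t.card + 1) * Real.exp (δ * n₀), fun U hU σ hk n => ?_⟩
    classical
    let E : V → Set V := fun x =>
      {w | ‖w‖ = 1 ∧ (∀ u ∈ U, inner ℝ u w = 0) ∧ w ∈ Metric.ball x (r / 2)}
    have hsub : word n '' Set.range (refn a L σ) ⊆
        (⋃ x ∈ t, word n '' (refn a L σ '' E x)) ∪ {word n (refn a L σ 0)} := by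
      rintro _ ⟨_, ⟨w, rfl⟩, rfl⟩
      obtain ⟨u, hu, z, hz, rfl⟩ := U.exists_add_mem_mem_orthogonal w
      rw [refn_add_of_kills a L σ U hk u z hu]
      by_cases hz0 : z = 0
      · right; simp [hz0]
      · left
        have hzn : 0 < ‖z‖ := norm_pos_iff.2 hz0
        have hz1 : ‖z‖⁻¹ • z ∈ Metric.sphere (0 : V) 1 := by
          rw [mem_sphere_zero_iff_norm, norm_smul, norm_inv, norm_norm]
          field_simp
        obtain ⟨x, hx, hxb⟩ := Set.mem_iUnion₂.1 (htcov hz1)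
        refine Set.mem_iUnion₂.2 ⟨x, hx, _, ⟨‖z‖⁻¹ • z, ⟨?_, ?_, hxb⟩, rfl⟩, ?_⟩
        · simpa using hz1
        · intro v hv
          rw [inner_smul_right, (Submodule.mem_orthogonal U z).1 hz v hv, mul_zero]
        · rw [refn_smul a L σ z _ (by positivity)]
    have hE : ∀ x, ((word n '' (refn a L σ '' E x)).ncard : ℝ) ≤
        Real.exp (δ * n₀) * Real.exp (δ * n) := by
      intro x
      apply hg
      right
      refine ⟨σ, U, 1, E x, hk, hU, one_pos, fun w hw => ⟨hw.1, hw.2.1⟩, ?_, rfl⟩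
      intro w hw w' hw'
      have h1 := Metric.mem_ball.1 hw.2.2
      have h2 := Metric.mem_ball'.1 hw'.2.2
      have := dist_triangle w x w'
      linarith
    have hfinU : (⋃ x ∈ t, word n '' (refn a L σ '' E x)).Finite :=
      t.finite_toSet.biUnion fun x _ => words_finite _ _
    have h1 : (word n '' Set.range (refn a L σ)).ncard ≤
        (⋃ x ∈ t, word n '' (refn a L σ '' E x)).ncard + 1 := by
      refine (Set.ncard_le_ncard hsub (hfinU.union (Set.finite_singleton _))).trans ?_
      refine (Set.ncard_union_le _ _).trans ?_
      rw [Set.ncard_singleton]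
    have h2 : (⋃ x ∈ t, word n '' (refn a L σ '' E x)).ncard ≤
        ∑ x ∈ t, (word n '' (refn a L σ '' E x)).ncard := Finset.set_ncard_biUnion_le _ _
    have h3 : ((∑ x ∈ t, (word n '' (refn a L σ '' E x)).ncard : ℕ) : ℝ) ≤
        t.card * (Real.exp (δ * n₀) * Real.exp (δ * n)) := by
      push_cast
      rw [← nsmul_eq_mul]
      exact Finset.sum_le_card_nsmul _ _ _ fun x _ => hE x
    have h4 : ((word n '' Set.range (refn a L σ)).ncard : ℝ) ≤
        ((∑ x ∈ t, (word n '' (refn a L σ '' E x)).ncard : ℕ) : ℝ) + 1 := by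
      exact_mod_cast h1.trans (Nat.add_le_add_right h2 1)
    have h5 : (1 : ℝ) ≤ Real.exp (δ * n₀) * Real.exp (δ * n) :=
      one_le_mul_of_one_le_of_one_le hexp1 (Real.one_le_exp (by positivity))
    linarith

end lin

section aff
variable {ι : Type} {V : Type} [NormedAddCommGroup V] [InnerProductSpace ℝ V]
  (l : ι → V →ᵃ[ℝ] ℝ) (A : Sym ι → V →ᵃ[ℝ] V)

/-- Composition of the affine maps along a history. -/
noncomputable def Ah : List (Sym ι) → V →ᵃ[ℝ] V
  | [] => AffineMap.id ℝ V
  | e :: h => (Ah h).comp (A e)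

lemma Ah_linear (h : List (Sym ι)) : (Ah A h).linear = Lh (fun e => (A e).linear) h := by
  induction h with
  | nil => rfl
  | cons e h ih => simp [Ah, Lh, ih]

/-- The strategy of a point. -/
noncomputable def stratOf (y : V) : Strat ι := fun h j => SignType.sign (l j (Ah A h y))

lemma next_stratOf (y : V) : next (stratOf l A y) = stratOf l A (A (stratOf l A y []) y) := by
  funext h j
  simp [next, stratOf, Ah]

lemma eval_diff (h : List (Sym ι)) (j : ι) (x y : V) :
    l j (Ah A h y) = l j (Ah A h x) + (l j).linear (Lh (fun e => (A e).linear) h (y - x)) := by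
  rw [← Ah_linear, ← vsub_eq_sub y x, AffineMap.linearMap_vsub, AffineMap.linearMap_vsub]
  simp

lemma local_radius_aff [Finite ι] [FiniteDimensional ℝ V] (n : ℕ) (x : V) :
    ∃ ρ > 0, ∀ y ∈ Metric.ball x ρ,
      word n (stratOf l A y) =
        word n (refn (fun j => (l j).linear) (fun e => (A e).linear) (stratOf l A x) (y - x)) := by
  have hev : ∀ᶠ w in nhds x, ∀ h ∈ {h : List (Sym ι) | h.length < n}, ∀ j,
      l j (Ah A h x) ≠ 0 →
        SignType.sign (l j (Ah A h w)) = SignType.sign (l j (Ah A h x)) := by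
    rw [Filter.eventually_all_finite (List.finite_length_lt (Sym ι) n)]
    intro h _
    rw [Filter.eventually_all]
    intro j
    by_cases h0 : l j (Ah A h x) = 0
    · simp [h0]
    · have hc : Continuous (fun w => l j (Ah A h w)) :=
        ((l j).comp (Ah A h)).continuous_of_finiteDimensional
      rcases lt_or_gt_of_ne h0 with h1 | h1
      · filter_upwards [hc.continuousAt.eventually (gt_mem_nhds h1)] with w hw _
        rw [sign_neg hw, sign_neg h1]
      · filter_upwards [hc.continuousAt.eventually (lt_mem_nhds h1)] with w hw _
        rw [sign_pos hw, sign_pos h1]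
  obtain ⟨ρ, hρ, hball⟩ := Metric.eventually_nhds_iff_ball.1 hev
  refine ⟨ρ, hρ, fun y hy => word_congr n _ _ fun h hh => ?_⟩
  funext j
  have := hball y hy h hh j
  by_cases h1 : l j (Ah A h x) = 0
  · have h2 := eval_diff l A h j x y
    rw [h1, zero_add] at h2
    simp only [stratOf, refn, h1, sign_zero, if_true]
    rw [h2]
  · simp only [stratOf, refn, sign_eq_zero_iff, h1, if_false]
    exact this h1


lemma A_dist
    (c : Sym ι → ℝ) (hL : ∀ e v, ‖(A e).linear v‖ = c e * ‖v‖) (hc1 : ∀ e, c e ≤ 1) (e : Sym ι) (x y : V) : dist (A e x) (A e y) ≤ dist x y := by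
  rw [dist_eq_norm, dist_eq_norm, ← vsub_eq_sub (A e x), ← AffineMap.linearMap_vsub, hL,
    vsub_eq_sub]
  have := hc1 e
  nlinarith [norm_nonneg (x - y)]

theorem affine_growth
    (c : Sym ι → ℝ) (hL : ∀ e v, ‖(A e).linear v‖ = c e * ‖v‖) (hc : ∀ e, 0 ≤ c e) (hc1 : ∀ e, c e ≤ 1) (X : Set V) (f : V → V) (hf : Set.MapsTo f X X) (hfA : ∀ y ∈ X, f y = A (stratOf l A y []) y) [Finite ι] [FiniteDimensional ℝ V] (hX : IsCompact X) (δ : ℝ) (hδ : 0 < δ) :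
    ∃ C : ℝ, ∃ r > 0, ∀ E ⊆ X, (∀ x ∈ E, ∀ y ∈ E, dist x y < r) → ∀ n : ℕ,
      ((word n '' (stratOf l A '' E)).ncard : ℝ) ≤ C * Real.exp (δ * n) := by
  obtain ⟨C, hC⟩ := linear_growth (fun j => (l j).linear) (fun e => (A e).linear) c hL hc
    (Module.finrank ℝ V) (δ / 2) (by positivity)
  obtain ⟨n₀, hn₀, hCn⟩ := exists_time C δ hδ
  choose ρ hρ hloc using local_radius_aff l A n₀
  obtain ⟨r, hr, hleb⟩ := lebesgue_number_lemma_of_metric (c := fun x : V =>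
      Metric.ball x (ρ x)) hX (fun _ => Metric.isOpen_ball) (by
        intro w hw
        exact Set.mem_iUnion.2 ⟨w, Metric.mem_ball_self (hρ w)⟩)
  let 𝒟 : Set (Set (Strat ι)) := {D | ∃ E ⊆ X, (∀ x ∈ E, ∀ y ∈ E, dist x y < r) ∧
    D = stratOf l A '' E}
  have hstep : ∀ D ∈ 𝒟, ∀ e, next '' {σ ∈ D | σ [] = e} ∈ 𝒟 := by
    rintro _ ⟨E, hEX, hEr, rfl⟩ e
    refine ⟨f '' {y ∈ E | stratOf l A y [] = e}, ?_, ?_, ?_⟩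
    · rintro _ ⟨y, ⟨hy, -⟩, rfl⟩
      exact hf (hEX hy)
    · rintro _ ⟨y, ⟨hy, he⟩, rfl⟩ _ ⟨y', ⟨hy', he'⟩, rfl⟩
      rw [hfA y (hEX hy), hfA y' (hEX hy'), he, he']
      exact (A_dist A c hL hc1 e y y').trans_lt (hEr y hy y' hy')
    · ext τ
      constructor
      · rintro ⟨_, ⟨⟨y, hy, rfl⟩, he⟩, rfl⟩
        exact ⟨f y, ⟨y, ⟨hy, he⟩, rfl⟩, by rw [next_stratOf, hfA y (hEX hy)]⟩
      · rintro ⟨_, ⟨y, ⟨hy, he⟩, rfl⟩, rfl⟩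
        exact ⟨_, ⟨⟨y, hy, rfl⟩, he⟩, by rw [next_stratOf, hfA y (hEX hy)]⟩
  have hM : ∀ D ∈ 𝒟, ((word n₀ '' D).ncard : ℝ) ≤ Real.exp (δ * n₀) := by
    rintro _ ⟨E, hEX, hEr, rfl⟩
    rcases E.eq_empty_or_nonempty with rfl | ⟨y₁, hy₁⟩
    · simp; positivity
    obtain ⟨x, hball⟩ := hleb y₁ (hEX hy₁)
    have hcount := hC ⊥ (by simp) (stratOf l A x) (by
      intro h j _ u hu
      rw [(Submodule.mem_bot ℝ).1 hu]; simp) n₀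
    have hsub : word n₀ '' (stratOf l A '' E) ⊆ word n₀ '' Set.range
        (refn (fun j => (l j).linear) (fun e => (A e).linear) (stratOf l A x)) := by
      rintro _ ⟨_, ⟨y, hy, rfl⟩, rfl⟩
      exact ⟨_, ⟨y - x, rfl⟩, (hloc x y (hball (hEr y hy y₁ hy₁))).symm⟩
    have h5 := Set.ncard_le_ncard hsub (words_finite _ _)
    have h6 : ((word n₀ '' (stratOf l A '' E)).ncard : ℝ) ≤ ((word n₀ '' Set.range
        (refn (fun j => (l j).linear) (fun e => (A e).linear) (stratOf l A x))).ncard : ℝ) := by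
      exact_mod_cast h5
    linarith
  refine ⟨Real.exp (δ * n₀), r, hr, fun E hEX hEr n => ?_⟩
  exact growth 𝒟 hstep n₀ hn₀ δ hδ.le hM _ ⟨E, hEX, hEr, rfl⟩ n

lemma orbit_close
    (c : Sym ι → ℝ) (hL : ∀ e v, ‖(A e).linear v‖ = c e * ‖v‖) (hc1 : ∀ e, c e ≤ 1) (X : Set V) (f : V → V) (hf : Set.MapsTo f X X) (hfA : ∀ y ∈ X, f y = A (stratOf l A y []) y) (n : ℕ) : ∀ x ∈ X, ∀ y ∈ X, word n (stratOf l A x) = word n (stratOf l A y) →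
    ∀ k < n, dist (f^[k] x) (f^[k] y) ≤ dist x y := by
  induction n with
  | zero => intro x _ y _ _ k hk; omega
  | succ n ih =>
    intro x hx y hy hw k hk
    cases k with
    | zero => simp
    | succ k =>
      simp only [word, List.cons.injEq, next_stratOf, ← hfA x hx, ← hfA y hy] at hw
      rw [Function.iterate_succ_apply, Function.iterate_succ_apply]
      refine (ih (f x) (hf hx) (f y) (hf hy) hw.2 k (by omega)).trans ?_
      rw [hfA x hx, hfA y hy, hw.1]
      exact A_dist A c hL hc1 _ x y

theorem entropy_zero_aux
    (c : Sym ι → ℝ) (hL : ∀ e v, ‖(A e).linear v‖ = c e * ‖v‖) (hc : ∀ e, 0 ≤ c e) (hc1 : ∀ e, c e ≤ 1) (X : Set V) (f : V → V) (hf : Set.MapsTo f X X) (hfA : ∀ y ∈ X, f y = A (stratOf l A y []) y) [Finite ι] [FiniteDimensional ℝ V] (hX : IsCompact X)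
    (hne : X.Nonempty) : Dynamics.coverEntropy f X = 0 := by
  classical
  refine le_antisymm ?_ (Dynamics.coverEntropy_nonneg f hne)
  rw [Dynamics.coverEntropy_eq_iSup_basis Metric.uniformity_basis_dist]
  refine iSup₂_le fun ε hε => ?_
  refine EReal.le_of_forall_lt_iff_le.1 fun δ hδ => ?_
  have hδ' : (0 : ℝ) < δ := by exact_mod_cast hδ
  obtain ⟨C, r, hr, hC⟩ := affine_growth l A c hL hc hc1 X f hf hfA hX δ hδ'
  obtain ⟨t, -, htfin, htcov⟩ := hX.finite_cover_balls (e := min r ε / 2) (by positivity)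
  lift t to Finset V using htfin
  let E : V → Set V := fun x => X ∩ Metric.ball x (min r ε / 2)
  have hEd : ∀ x, ∀ y ∈ E x, ∀ z ∈ E x, dist y z < min r ε := by
    intro x y hy z hz
    have h1 := Metric.mem_ball.1 hy.2
    have h2 := Metric.mem_ball'.1 hz.2
    have := dist_triangle y x z
    linarith
  have hbound : ∀ n : ℕ, ((Dynamics.coverMincard f X {p : V × V | dist p.1 p.2 < ε} n : ℕ∞) :
      ENNReal) ≤ ENNReal.ofReal (t.card * C) * EReal.exp ((δ : EReal) * n) := by
    intro n
    have hfin : ∀ x, (word n '' (stratOf l A '' E x)).Finite := fun x => words_finite _ _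
    let R : V → List (Sym ι) → V := fun x w =>
      if h : ∃ y ∈ E x, word n (stratOf l A y) = w then h.choose else 0
    let S : Finset V := t.biUnion fun x => (hfin x).toFinset.image (R x)
    have hcov : Dynamics.IsDynCoverOf f X {p : V × V | dist p.1 p.2 < ε} n (S : Set V) := by
      intro y hy
      obtain ⟨x, hx, hyx⟩ := Set.mem_iUnion₂.1 (htcov hy)
      have hyE : y ∈ E x := ⟨hy, hyx⟩
      have hex : ∃ z ∈ E x, word n (stratOf l A z) = word n (stratOf l A y) := ⟨y, hyE, rfl⟩
      refine ⟨R x (word n (stratOf l A y)), ?_, ?_⟩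
      · simp only [S, Finset.coe_biUnion, Set.mem_iUnion]
        refine ⟨x, hx, ?_⟩
        rw [Finset.mem_coe]
        apply Finset.mem_image_of_mem
        simp only [Set.Finite.mem_toFinset]
        exact ⟨_, ⟨y, hyE, rfl⟩, rfl⟩
      · have hR : R x (word n (stratOf l A y)) = hex.choose := dif_pos hex
        rw [hR]
        obtain ⟨h1, h2⟩ := hex.choose_spec
        rw [Dynamics.mem_dynEntourage]
        intro k hk
        have := orbit_close l A c hL hc1 X f hf hfA n y hy _ h1.1 h2.symm k hk
        have h3 := hEd x y hyE _ h1
        exact this.trans_lt (h3.trans_le (min_le_right _ _))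
    have hcard : (S.card : ℝ) ≤ t.card * C * Real.exp (δ * n) := by
      have h1 : S.card ≤ ∑ x ∈ t, (word n '' (stratOf l A '' E x)).ncard := by
        refine Finset.card_biUnion_le.trans (Finset.sum_le_sum fun x _ => ?_)
        refine Finset.card_image_le.trans ?_
        rw [← Set.ncard_eq_toFinset_card _ (hfin x)]
      have h2 : ((∑ x ∈ t, (word n '' (stratOf l A '' E x)).ncard : ℕ) : ℝ) ≤
          t.card * (C * Real.exp (δ * n)) := by
        push_cast
        rw [← nsmul_eq_mul]
        exact Finset.sum_le_card_nsmul _ _ _ fun x _ => hC (E x) Set.inter_subset_left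
          (fun y hy z hz => (hEd x y hy z hz).trans_le (min_le_left _ _)) n
      have h3 : (S.card : ℝ) ≤ ((∑ x ∈ t, (word n '' (stratOf l A '' E x)).ncard : ℕ) : ℝ) := by
        exact_mod_cast h1
      linarith
    have h1 := hcov.coverMincard_le_card
    have h2 : ((Dynamics.coverMincard f X {p : V × V | dist p.1 p.2 < ε} n : ℕ∞) :
      ENNReal) ≤ ((S.card : ℕ∞) : ENNReal) := ENat.toENNReal_mono h1
    refine h2.trans ?_
    have h3 : ((S.card : ℕ∞) : ENNReal) = ENNReal.ofReal (S.card : ℝ) := by simp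
    rw [h3]
    refine (ENNReal.ofReal_le_ofReal hcard).trans ?_
    rw [ENNReal.ofReal_mul' (Real.exp_pos _).le]
    have h4 : (δ : EReal) * n = ((δ * n : ℝ) : EReal) := by push_cast; rfl
    rw [h4, EReal.exp_coe]
  refine (ExpGrowth.expGrowthSup_le_of_eventually_le (b := ENNReal.ofReal (t.card * C))
    ENNReal.ofReal_ne_top (Filter.Eventually.of_forall hbound)).trans ?_
  rw [ExpGrowth.expGrowthSup_exp]

end aff

section sep

/-- Weak separation of a convex set from the origin. -/
lemma exists_nonpos {W : Type} [NormedAddCommGroup W] [NormedSpace ℝ W] [FiniteDimensional ℝ W]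
    (K : Set W) (hK : Convex ℝ K) (hne : K.Nonempty) (h0 : (0 : W) ∉ K) :
    ∃ a : W →ₗ[ℝ] ℝ, a ≠ 0 ∧ ∀ x ∈ K, a x ≤ 0 := by
  by_cases hint : (interior K).Nonempty
  · obtain ⟨g, hg, hg'⟩ := geometric_hahn_banach_of_nonempty_interior_point hK
      (fun h => h0 (interior_subset h)) hint
    refine ⟨g, ?_, fun x hx => by simpa using hg' x hx⟩
    intro h
    apply hg
    ext x
    exact LinearMap.congr_fun h x
  · rw [hK.interior_nonempty_iff_affineSpan_eq_top] at hint
    obtain ⟨x₀, hx₀⟩ := hne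
    have hdir : (affineSpan ℝ K).direction < ⊤ := by
      rw [lt_top_iff_ne_top]
      intro h
      exact hint ((AffineSubspace.direction_eq_top_iff_of_nonempty
        ⟨x₀, subset_affineSpan ℝ K hx₀⟩).1 h)
    obtain ⟨a, ha, hker⟩ := Submodule.exists_le_ker_of_lt_top _ hdir
    have hconst : ∀ x ∈ K, a x = a x₀ := by
      intro x hx
      have := hker (AffineSubspace.vsub_mem_direction (subset_affineSpan ℝ K hx)
        (subset_affineSpan ℝ K hx₀))
      rw [LinearMap.mem_ker, vsub_eq_sub, map_sub] at this
      linarith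
    rcases le_total (a x₀) 0 with h | h
    · exact ⟨a, ha, fun x hx => by rw [hconst x hx]; exact h⟩
    · exact ⟨-a, neg_ne_zero.2 ha, fun x hx => by simp [hconst x hx, h]⟩

open scoped Pointwise in
/-- Disjoint convex sets are distinguished by the signs of finitely many affine functionals. -/
lemma exists_sep {V : Type} [NormedAddCommGroup V] [InnerProductSpace ℝ V]
    [FiniteDimensional ℝ V] (n : ℕ) : ∀ (W : Submodule ℝ V), Module.finrank ℝ W ≤ n →
    ∀ P Q : Set V, Convex ℝ P → Convex ℝ Q → Disjoint P Q →
      (∀ x ∈ P, ∀ y ∈ Q, x - y ∈ W) →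
      ∃ S : List (V →ᵃ[ℝ] ℝ), ∀ x ∈ P, ∀ y ∈ Q,
        ∃ g ∈ S, SignType.sign (g x) ≠ SignType.sign (g y) := by
  induction n with
  | zero =>
    intro W hW P Q _ _ hd hPQ
    refine ⟨[], fun x hx y hy => ?_⟩
    have hW0 : W = ⊥ := Submodule.finrank_eq_zero.1 (by omega)
    have := hPQ x hx y hy
    rw [hW0, Submodule.mem_bot, sub_eq_zero] at this
    exact absurd hy (this ▸ Set.disjoint_left.1 hd hx)
  | succ n ih =>
    intro W hW P Q hP hQ hd hPQ
    rcases P.eq_empty_or_nonempty with rfl | ⟨p₀, hp₀⟩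
    · exact ⟨[], by simp⟩
    rcases Q.eq_empty_or_nonempty with rfl | ⟨q₀, hq₀⟩
    · exact ⟨[], by simp⟩
    let K : Set W := W.subtype ⁻¹' (P - Q)
    have hK : Convex ℝ K := (hP.sub hQ).linear_preimage W.subtype
    have hmem : ∀ x (hx : x ∈ P) y (hy : y ∈ Q), (⟨x - y, hPQ x hx y hy⟩ : W) ∈ K := by
      intro x hx y hy
      exact Set.sub_mem_sub hx hy
    have h0 : (0 : W) ∉ K := by
      rintro ⟨x, hx, y, hy, hxy⟩
      simp only [map_zero, sub_eq_zero] at hxy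
      exact Set.disjoint_left.1 hd hx (hxy ▸ hy)
    obtain ⟨a, ha, hneg⟩ := exists_nonpos K hK ⟨_, hmem p₀ hp₀ q₀ hq₀⟩ h0
    obtain ⟨b, hb⟩ := LinearMap.exists_extend a
    have hbW : ∀ w : W, b w = a w := fun w => LinearMap.congr_fun hb w
    have hle : ∀ x ∈ P, ∀ y ∈ Q, b x ≤ b y := by
      intro x hx y hy
      have h1 := hneg _ (hmem x hx y hy)
      rw [← hbW] at h1
      simp only [map_sub] at h1
      linarith
    set t := sSup (b '' P) with ht
    have hPt : ∀ x ∈ P, b x ≤ t := fun x hx =>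
      le_csSup ⟨b q₀, by rintro _ ⟨x, hx, rfl⟩; exact hle x hx q₀ hq₀⟩ ⟨x, hx, rfl⟩
    have hQt : ∀ y ∈ Q, t ≤ b y := fun y hy =>
      csSup_le ⟨_, p₀, hp₀, rfl⟩ (by rintro _ ⟨x, hx, rfl⟩; exact hle x hx y hy)
    have hlt : W ⊓ LinearMap.ker b < W := by
      refine lt_of_le_of_ne inf_le_left fun h => ha ?_
      ext w
      have : (w : V) ∈ W ⊓ LinearMap.ker b := by rw [h]; exact w.2
      rw [← hbW]
      simpa using this.2
    have hfr := Submodule.finrank_lt_finrank_of_lt hlt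
    have hconv : Convex ℝ {x : V | b x = t} := by
      have := (convex_singleton (𝕜 := ℝ) t).linear_preimage b
      exact this
    obtain ⟨S, hS⟩ := ih (W ⊓ LinearMap.ker b) (by omega) (P ∩ {x | b x = t}) (Q ∩ {x | b x = t})
      (hP.inter hconv) (hQ.inter hconv) (hd.mono Set.inter_subset_left Set.inter_subset_left) (by
        intro x hx y hy
        refine ⟨hPQ x hx.1 y hy.1, ?_⟩
        have h1 : b x = t := hx.2
        have h2 : b y = t := hy.2
        simp [h1, h2])
    refine ⟨(b.toAffineMap - AffineMap.const ℝ V t) :: S, fun x hx y hy => ?_⟩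
    by_cases hxy : b x = t ∧ b y = t
    · obtain ⟨g, hg, hne⟩ := hS x ⟨hx, hxy.1⟩ y ⟨hy, hxy.2⟩
      exact ⟨g, List.mem_cons_of_mem _ hg, hne⟩
    · refine ⟨_, List.mem_cons_self, ?_⟩
      intro hs
      have e : ∀ z, (b.toAffineMap - AffineMap.const ℝ V t) z = b z - t := fun z => by simp
      rw [e, e] at hs
      have h1 := hPt x hx
      have h2 := hQt y hy
      rcases h1.lt_or_eq with h1 | h1
      · rw [sign_neg (sub_neg.2 h1)] at hs
        have := sign_eq_neg_one_iff.1 hs.symm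
        linarith
      · rw [h1, sub_self, sign_zero] at hs
        have := sign_eq_zero_iff.1 hs.symm
        exact hxy ⟨h1, by linarith⟩

end sep

end PAC


/-- Let `X ⊆ ℝ^d` be a nonempty compact set, partitioned into finitely many
pairwise disjoint convex pieces `P 1, …, P k`, and let `f : X → X` agree on each piece with an
affine map of `ℝ^d` whose linear part is a conformal non-strict contraction
(`‖L v‖ = c·‖v‖` for some constant `c ≤ 1`). Then the topological entropy of `f` is zero. -/
theorem entropy_zero_of_piecewise_affine_conformal_contraction
    (d k : ℕ) (X : Set (EuclideanSpace ℝ (Fin d)))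
    (hX : IsCompact X) (hXne : X.Nonempty)
    (P : Fin k → Set (EuclideanSpace ℝ (Fin d)))
    (hconv : ∀ i, Convex ℝ (P i))
    (hdisj : Pairwise (Function.onFun Disjoint P))
    (hunion : ⋃ i, P i = X)
    (f : EuclideanSpace ℝ (Fin d) → EuclideanSpace ℝ (Fin d))
    (hf : Set.MapsTo f X X)
    (haff : ∀ i, ∃ A : EuclideanSpace ℝ (Fin d) →ᵃ[ℝ] EuclideanSpace ℝ (Fin d),
      Set.EqOn f A (P i) ∧ ∃ c : ℝ, c ≤ 1 ∧ ∀ v, ‖A.linear v‖ = c * ‖v‖) :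
    Dynamics.coverEntropy f X = 0 := by
  classical
  have hsep : ∀ q : Fin k × Fin k, ∃ S : List (EuclideanSpace ℝ (Fin d) →ᵃ[ℝ] ℝ), q.1 ≠ q.2 →
      ∀ x ∈ P q.1, ∀ y ∈ P q.2, ∃ g ∈ S, SignType.sign (g x) ≠ SignType.sign (g y) := by
    intro q
    by_cases hq : q.1 = q.2
    · exact ⟨[], fun h => absurd hq h⟩
    · obtain ⟨S, hS⟩ := PAC.exists_sep _ (⊤ : Submodule ℝ (EuclideanSpace ℝ (Fin d))) le_rfl
        (P q.1) (P q.2) (hconv _) (hconv _) (hdisj hq) (fun _ _ _ _ => Submodule.mem_top)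
      exact ⟨S, fun _ => hS⟩
  choose S hS using hsep
  let ι : Type := Σ q : Fin k × Fin k, Fin (S q).length
  let l : ι → EuclideanSpace ℝ (Fin d) →ᵃ[ℝ] ℝ := fun j => (S j.1).get j.2
  choose B hB c hc1 hcB using haff
  let sg : EuclideanSpace ℝ (Fin d) → PAC.Sym ι := fun y j => SignType.sign (l j y)
  have hdet : ∀ i i' x y, x ∈ P i → y ∈ P i' → sg x = sg y → i = i' := by
    intro i i' x y hx hy hxy
    by_contra hne
    obtain ⟨g, hg, hs⟩ := hS (i, i') hne x hx y hy
    obtain ⟨m, rfl⟩ := List.get_of_mem hg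
    exact hs (congrFun hxy ⟨(i, i'), m⟩)
  let A : PAC.Sym ι → EuclideanSpace ℝ (Fin d) →ᵃ[ℝ] EuclideanSpace ℝ (Fin d) := fun e =>
    if h : ∃ i, ∃ x ∈ P i, sg x = e then B h.choose else AffineMap.id ℝ _
  let c' : PAC.Sym ι → ℝ := fun e =>
    if h : ∃ i, ∃ x ∈ P i, sg x = e then max (c h.choose) 0 else 1
  have hL : ∀ e v, ‖(A e).linear v‖ = c' e * ‖v‖ := by
    intro e v
    by_cases h : ∃ i, ∃ x ∈ P i, sg x = e
    · simp only [A, c', dif_pos h]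
      rw [hcB]
      rcases le_total 0 (c h.choose) with h0 | h0
      · rw [max_eq_left h0]
      · rw [max_eq_right h0]
        have h1 := norm_nonneg ((B h.choose).linear v)
        rw [hcB] at h1
        have h2 := mul_nonpos_of_nonpos_of_nonneg h0 (norm_nonneg v)
        linarith
    · simp [A, c', dif_neg h]
  have hc0 : ∀ e, 0 ≤ c' e := by
    intro e
    by_cases h : ∃ i, ∃ x ∈ P i, sg x = e
    · simp only [c', dif_pos h]; exact le_max_right _ _
    · simp [c', dif_neg h]
  have hcle : ∀ e, c' e ≤ 1 := by
    intro e
    by_cases h : ∃ i, ∃ x ∈ P i, sg x = e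
    · simp only [c', dif_pos h]; exact max_le (hc1 _) zero_le_one
    · simp [c', dif_neg h]
  have hfA : ∀ y ∈ X, f y = A (PAC.stratOf l A y []) y := by
    intro y hy
    rw [← hunion] at hy
    obtain ⟨i, hi⟩ := Set.mem_iUnion.1 hy
    have hst : PAC.stratOf l A y [] = sg y := rfl
    rw [hst]
    have h : ∃ i, ∃ x ∈ P i, sg x = sg y := ⟨i, y, hi, rfl⟩
    obtain ⟨x, hx, hxy⟩ := h.choose_spec
    have hii : h.choose = i := hdet _ _ x y hx hi hxy
    simp only [A, dif_pos h]
    rw [hii]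
    exact hB i hi
  exact PAC.entropy_zero_aux l A c' hL hc0 hcle X f hf hfA hX hXne
end
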